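/- arXiv:0901.1025 — 4 statements merged into one kernel-verified Lean document; each statement's English description precedes it below -/
import Mathlib

section
/- Let X be a Banach space, N ≥ 1, and let u : ℓ^∞_N → B(X) be a bounded unital algebra homomorphism. Let (e_1,...,e_N) be the canonical basis of ℓ^∞_N and set p_i = u(e_i). Then for any operators b_1,...,b_N ∈ B(X) commuting with every element of the range of u, we have ‖Σ_{i=1}^N p_i b_i‖ ≤ ‖u‖² · R({b_1,...,b_N}). -/
open Finset

/-- The Rademacher average, modelled on the uniform probability space `Fin n → Bool`. -/
noncomputable def radNorm {X : Type*} [NormedAddCommGroup X] [NormedSpace ℂ X]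
    {n : ℕ} (x : Fin n → X) : ℝ :=
  Real.sqrt ((∑ s : Fin n → Bool, ‖∑ k, (if s k then (1 : ℂ) else -1) • x k‖ ^ 2) / 2 ^ n)

/-- `τ ⊆ B(X)` is `R`-bounded with bound `C`. -/
def IsRBoundedWith {X : Type*} [NormedAddCommGroup X] [NormedSpace ℂ X]
    (C : ℝ) (τ : Set (X →L[ℂ] X)) : Prop :=
  0 ≤ C ∧ ∀ (n : ℕ) (T : Fin n → X →L[ℂ] X) (x : Fin n → X), (∀ k, T k ∈ τ) →
    radNorm (fun k => T k (x k)) ≤ C * radNorm x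

/-- The `R`-bound of a set of operators: the smallest admissible constant. -/
noncomputable def RBound {X : Type*} [NormedAddCommGroup X] [NormedSpace ℂ X]
    (τ : Set (X →L[ℂ] X)) : ℝ :=
  sInf {C : ℝ | IsRBoundedWith C τ}

section RademacherAverages

variable {X : Type*} [NormedAddCommGroup X] [NormedSpace ℂ X]

lemma radNorm_le_of_forall_norm_le {n : ℕ} {x : Fin n → X} {c : ℝ} (hc : 0 ≤ c)
    (h : ∀ s : Fin n → Bool, ‖∑ k, (if s k then (1 : ℂ) else -1) • x k‖ ≤ c) :
    radNorm x ≤ c := by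
  refine Real.sqrt_le_iff.2 ⟨hc, ?_⟩
  rw [div_le_iff₀ (by positivity)]
  calc ∑ s : Fin n → Bool, ‖∑ k, (if s k then (1 : ℂ) else -1) • x k‖ ^ 2
      ≤ ∑ _s : Fin n → Bool, c ^ 2 := by gcongr with s; exact h s
    _ = c ^ 2 * 2 ^ n := by simp [mul_comm]

lemma le_radNorm_of_forall_le_norm {n : ℕ} {x : Fin n → X} {c : ℝ} (hc : 0 ≤ c)
    (h : ∀ s : Fin n → Bool, c ≤ ‖∑ k, (if s k then (1 : ℂ) else -1) • x k‖) :
    c ≤ radNorm x := by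
  refine Real.le_sqrt_of_sq_le ?_
  rw [le_div_iff₀ (by positivity)]
  calc c ^ 2 * 2 ^ n = ∑ _s : Fin n → Bool, c ^ 2 := by simp [mul_comm]
    _ ≤ ∑ s : Fin n → Bool, ‖∑ k, (if s k then (1 : ℂ) else -1) • x k‖ ^ 2 := by
      gcongr with s; exact h s

/-- Restricting a Rademacher sum to a subset of indices does not increase its second moment. -/
lemma sum_norm_sq_restrict_le {n : ℕ} (x : Fin n → X) (A : Fin n → Prop) [DecidablePred A] :
    ∑ s : Fin n → Bool, ‖∑ k with A k, (if s k then (1 : ℂ) else -1) • x k‖ ^ 2 ≤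
      ∑ s : Fin n → Bool, ‖∑ k, (if s k then (1 : ℂ) else -1) • x k‖ ^ 2 := by
  set F : (Fin n → Bool) → X := fun s => ∑ k, (if s k then (1 : ℂ) else -1) • x k with hF
  let flip : (Fin n → Bool) → (Fin n → Bool) := fun s k => if A k then s k else !s k
  have hflip : Function.Involutive flip := by
    intro s
    funext k
    by_cases hk : A k <;> simp [flip, hk]
  have hsum : ∑ s, ‖F (flip s)‖ ^ 2 = ∑ s, ‖F s‖ ^ 2 :=
    Equiv.sum_comp hflip.toPerm (fun s => ‖F s‖ ^ 2)
  have hmid : ∀ s, (2 : ℂ) • ∑ k with A k, (if s k then (1 : ℂ) else -1) • x k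
      = F s + F (flip s) := by
    intro s
    rw [hF, ← Finset.sum_add_distrib, Finset.sum_filter, Finset.smul_sum]
    refine Finset.sum_congr rfl fun k _ => ?_
    by_cases hk : A k <;> cases hs : s k <;> simp [flip, hk, hs, two_smul]
  have hle : ∀ s, ‖∑ k with A k, (if s k then (1 : ℂ) else -1) • x k‖ ^ 2
      ≤ (‖F s‖ ^ 2 + ‖F (flip s)‖ ^ 2) / 2 := by
    intro s
    have h := norm_add_le (F s) (F (flip s))
    rw [← hmid s, norm_smul, Complex.norm_ofNat] at h
    nlinarith [sq_nonneg (‖F s‖ - ‖F (flip s)‖),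
      norm_nonneg (∑ k with A k, (if s k then (1 : ℂ) else -1) • x k)]
  calc _ ≤ ∑ s, (‖F s‖ ^ 2 + ‖F (flip s)‖ ^ 2) / 2 := Finset.sum_le_sum fun s _ => hle s
    _ = ∑ s, ‖F s‖ ^ 2 := by
      rw [← Finset.sum_div, Finset.sum_add_distrib, hsum]; ring

/-- A finite family of bounded operators is `R`-bounded. -/
lemma exists_isRBoundedWith_range {ι : Type*} [Fintype ι] (b : ι → X →L[ℂ] X) :
    ∃ C, IsRBoundedWith C (Set.range b) := by
  classical
  set K : ℝ := Fintype.card ι * ∑ i, ‖b i‖ ^ 2 with hK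
  have hK0 : 0 ≤ K := by positivity
  refine ⟨Real.sqrt K, Real.sqrt_nonneg _, fun n T x hT => ?_⟩
  choose c hc using hT
  have hpt : ∀ s : Fin n → Bool, ‖∑ k, (if s k then (1 : ℂ) else -1) • T k (x k)‖ ^ 2 ≤
      Fintype.card ι * ∑ i, ‖b i‖ ^ 2 *
        ‖∑ k with c k = i, (if s k then (1 : ℂ) else -1) • x k‖ ^ 2 := by
    intro s
    have hsplit : ∑ k, (if s k then (1 : ℂ) else -1) • T k (x k)
        = ∑ i, b i (∑ k with c k = i, (if s k then (1 : ℂ) else -1) • x k) := by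
      rw [← Finset.sum_fiberwise Finset.univ c]
      refine Finset.sum_congr rfl fun i _ => ?_
      rw [map_sum]
      refine Finset.sum_congr rfl fun k hk => ?_
      rw [map_smul, ← hc k, (Finset.mem_filter.1 hk).2]
    calc ‖∑ k, (if s k then (1 : ℂ) else -1) • T k (x k)‖ ^ 2
        ≤ (∑ i, ‖b i‖ * ‖∑ k with c k = i, (if s k then (1 : ℂ) else -1) • x k‖) ^ 2 := by
          rw [hsplit]
          gcongr
          exact norm_sum_le_of_le _ fun i _ => (b i).le_opNorm _
      _ ≤ _ := by
          simpa only [mul_pow, Finset.card_univ] using sq_sum_le_card_mul_sum_sq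
            (s := Finset.univ)
            (f := fun i => ‖b i‖ * ‖∑ k with c k = i, (if s k then (1 : ℂ) else -1) • x k‖)
  rw [radNorm, radNorm, ← Real.sqrt_mul hK0, ← mul_div_assoc]
  refine Real.sqrt_le_sqrt ?_
  gcongr
  calc _ ≤ ∑ s : Fin n → Bool, Fintype.card ι * ∑ i, ‖b i‖ ^ 2 *
        ‖∑ k with c k = i, (if s k then (1 : ℂ) else -1) • x k‖ ^ 2 :=
        Finset.sum_le_sum fun s _ => hpt s
    _ = Fintype.card ι * ∑ i, ‖b i‖ ^ 2 * ∑ s : Fin n → Bool,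
        ‖∑ k with c k = i, (if s k then (1 : ℂ) else -1) • x k‖ ^ 2 := by
        rw [← Finset.mul_sum, Finset.sum_comm]
        simp only [Finset.mul_sum]
    _ ≤ Fintype.card ι * ∑ i, ‖b i‖ ^ 2 * ∑ s : Fin n → Bool,
        ‖∑ k, (if s k then (1 : ℂ) else -1) • x k‖ ^ 2 := by
        refine mul_le_mul_of_nonneg_left (Finset.sum_le_sum fun i _ => ?_) (by positivity)
        exact mul_le_mul_of_nonneg_left (sum_norm_sq_restrict_le x fun k => c k = i)
          (by positivity)
    _ = _ := by rw [hK, ← Finset.sum_mul, mul_assoc]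

end RademacherAverages

section Projections

variable {X : Type*} [NormedAddCommGroup X] [NormedSpace ℂ X] {N : ℕ}

lemma norm_map_sign_apply_le (u : (Fin N → ℂ) →L[ℂ] (X →L[ℂ] X)) (s : Fin N → Bool) (x : X) :
    ‖u (fun k => if s k then (1 : ℂ) else -1) x‖ ≤ ‖u‖ * ‖x‖ := by
  refine (ContinuousLinearMap.le_opNorm _ _).trans ?_
  gcongr
  refine (u.le_opNorm _).trans (mul_le_of_le_one_right (norm_nonneg _) ?_)
  refine (pi_norm_le_iff_of_nonneg zero_le_one).2 fun k => ?_
  split_ifs <;> simp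

lemma map_eq_sum_smul_map_single (u : (Fin N → ℂ) →L[ℂ] (X →L[ℂ] X)) (f : Fin N → ℂ) :
    u f = ∑ k, f k • u (Pi.single k 1) := by
  conv_lhs => rw [pi_eq_sum_univ' f]
  simp only [map_sum, map_smul]

lemma norm_sum_proj_comp_le_of_isRBoundedWith (u : (Fin N → ℂ) →L[ℂ] (X →L[ℂ] X))
    (hu_mul : ∀ f g : Fin N → ℂ, u (f * g) = u f * u g)
    (b : Fin N → X →L[ℂ] X)
    (hb : ∀ (i : Fin N) (f : Fin N → ℂ), b i * u f = u f * b i)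
    {C : ℝ} (hC : IsRBoundedWith C (Set.range b)) :
    ‖∑ i, u (Pi.single i 1) ∘L b i‖ ≤ ‖u‖ ^ 2 * C := by
  obtain ⟨hC0, hC⟩ := hC
  refine ContinuousLinearMap.opNorm_le_bound _ (by positivity) fun x => ?_
  set p : Fin N → X →L[ℂ] X := fun i => u (Pi.single i 1) with hp
  set S : X →L[ℂ] X := ∑ i, p i ∘L b i with hS
  have hcomm : ∀ i y, b i (p i y) = p i (b i y) := fun i y => DFunLike.congr_fun (hb i _) y
  have hupper : radNorm (fun i => p i x) ≤ ‖u‖ * ‖x‖ := by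
    refine radNorm_le_of_forall_norm_le (by positivity) fun s => ?_
    have h := norm_map_sign_apply_le u s x
    rw [map_eq_sum_smul_map_single] at h
    simpa only [_root_.sum_apply, _root_.smul_apply] using h
  have hkey : ∀ s : Fin N → Bool, ‖S x‖ ≤
      ‖u‖ * ‖∑ k, (if s k then (1 : ℂ) else -1) • b k (p k x)‖ := by
    intro s
    set f : Fin N → ℂ := fun k => if s k then (1 : ℂ) else -1 with hf
    have hfp : ∀ k, f k • u f * p k = p k := by
      intro k
      rw [smul_mul_assoc, hp, ← hu_mul, ← map_smul]
      congr 1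
      funext j
      by_cases hj : j = k
      · subst hj
        cases hs : s j <;> simp [hf, hs]
      · simp [hj]
    have hSx : S x = u f (∑ k, f k • b k (p k x)) := by
      simp only [hS, map_sum, map_smul, hcomm, _root_.sum_apply]
      refine Finset.sum_congr rfl fun k _ => ?_
      exact (DFunLike.congr_fun (hfp k) (b k x)).symm
    rw [hSx]
    exact norm_map_sign_apply_le u s _
  have hlower : ‖S x‖ ≤ ‖u‖ * radNorm (fun i => b i (p i x)) := by
    rcases (norm_nonneg u).eq_or_lt with h0 | hpos
    · simpa [← h0] using hkey fun _ => true
    · rw [← div_le_iff₀' hpos]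
      exact le_radNorm_of_forall_le_norm (by positivity) fun s => (div_le_iff₀' hpos).2 (hkey s)
  calc ‖S x‖ ≤ ‖u‖ * radNorm (fun i => b i (p i x)) := hlower
    _ ≤ ‖u‖ * (C * (‖u‖ * ‖x‖)) := by
      gcongr
      exact (hC N b (fun i => p i x) fun k => ⟨k, rfl⟩).trans (by gcongr)
    _ = ‖u‖ ^ 2 * C * ‖x‖ := by ring

end Projections

/-- Let `u : ℓ^∞_N → B(X)` be a bounded unital algebra homomorphism, `p_i = u(e_i)`
for the canonical basis `(e_i)`, and `b_1, …, b_N` operators commuting with the range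
of `u`. Then `‖Σ_i p_i b_i‖ ≤ ‖u‖² R({b_1, …, b_N})`. -/
theorem norm_sum_proj_comp_le {X : Type*} [NormedAddCommGroup X] [NormedSpace ℂ X]
    {N : ℕ} (hN : 1 ≤ N) (u : (Fin N → ℂ) →L[ℂ] (X →L[ℂ] X))
    (hu_one : u 1 = 1) (hu_mul : ∀ f g : Fin N → ℂ, u (f * g) = u f * u g)
    (b : Fin N → X →L[ℂ] X)
    (hb : ∀ (i : Fin N) (f : Fin N → ℂ), b i * u f = u f * b i) :
    ‖∑ i, u (Pi.single i 1) ∘L b i‖ ≤ ‖u‖ ^ 2 * RBound (Set.range b) := by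
  have hle := fun C hC =>
    norm_sum_proj_comp_le_of_isRBoundedWith u hu_mul b hb (C := C) hC
  obtain ⟨C, hC⟩ := exists_isRBoundedWith_range b
  rcases (sq_nonneg ‖u‖).eq_or_lt with h0 | hpos
  · simpa only [← h0, zero_mul] using hle C hC
  · rw [← div_le_iff₀' hpos]
    exact le_csInf ⟨C, hC⟩ fun D hD => (div_le_iff₀' hpos).2 (hle D hD)
end

section
/- Let X be a Banach space and τ ⊂ B(X). Let τ** = {T** : T ∈ τ} ⊂ B(X**). Then τ is R-bounded if and only if τ** is R-bounded, and in that case R(τ) = R(τ**). -/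
open Finset

/-- The adjoint (dual) map of a bounded operator, acting on the dual space. -/
noncomputable def dualCLM {X : Type*} [NormedAddCommGroup X] [NormedSpace ℂ X]
    (T : X →L[ℂ] X) : (X →L[ℂ] ℂ) →L[ℂ] (X →L[ℂ] ℂ) :=
  (ContinuousLinearMap.compL ℂ X X ℂ).flip T

/-- The bidual operator `T** : X** → X**` of `T : X → X`. -/
noncomputable def bidualCLM {X : Type*} [NormedAddCommGroup X] [NormedSpace ℂ X]
    (T : X →L[ℂ] X) : ((X →L[ℂ] ℂ) →L[ℂ] ℂ) →L[ℂ] ((X →L[ℂ] ℂ) →L[ℂ] ℂ) :=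
  dualCLM (dualCLM T)

theorem norm_sum_apply_le {E ι : Type*} [NormedAddCommGroup E] [NormedSpace ℂ E] [Fintype ι]
    (F : ι → E →L[ℂ] ℂ) (g : ι → E) :
    ‖∑ s, F s (g s)‖ ≤ √(∑ s, ‖F s‖ ^ 2) * √(∑ s, ‖g s‖ ^ 2) :=
  calc ‖∑ s, F s (g s)‖ ≤ ∑ s, ‖F s (g s)‖ := norm_sum_le _ _
    _ ≤ ∑ s, ‖F s‖ * ‖g s‖ := Finset.sum_le_sum fun s _ => (F s).le_opNorm _
    _ ≤ _ := Real.sum_mul_le_sqrt_mul_sqrt _ _ _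

/-- A functional almost attains its norm at a vector of norm at most its own norm. -/
theorem exists_apply_eq_mul_norm_sq {E : Type*} [NormedAddCommGroup E] [NormedSpace ℂ E]
    (F : E →L[ℂ] ℂ) {θ : ℝ} (h0 : 0 ≤ θ) (h1 : θ < 1) :
    ∃ g : E, ‖g‖ ≤ ‖F‖ ∧ F g = ((θ * ‖F‖ ^ 2 : ℝ) : ℂ) := by
  rcases eq_or_ne F 0 with rfl | hF
  · exact ⟨0, by simp⟩
  have hpos : 0 < ‖F‖ := norm_pos_iff.2 hF
  obtain ⟨u, hu, hFu⟩ := F.exists_lt_apply_of_lt_opNorm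
    (show θ * ‖F‖ < ‖F‖ by nlinarith)
  have hFu0 : 0 < ‖F u‖ := lt_of_le_of_lt (by positivity) hFu
  refine ⟨(((θ * ‖F‖ ^ 2 : ℝ) : ℂ) / F u) • u, ?_, ?_⟩
  · rw [norm_smul, norm_div, Complex.norm_real, Real.norm_of_nonneg (by positivity)]
    have h : θ * ‖F‖ ^ 2 / ‖F u‖ ≤ ‖F‖ := by
      rw [div_le_iff₀ hFu0]
      nlinarith
    calc _ ≤ ‖F‖ * 1 := by gcongr
      _ = ‖F‖ := mul_one _
  · rw [map_smul, smul_eq_mul, div_mul_cancel₀ _ (norm_pos_iff.1 hFu0)]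

/-- The dual norm of a finite `ℓ²`-sum dominates the `ℓ²`-sum of the dual norms. -/
theorem sqrt_sum_norm_sq_le_of_norm_sum_apply_le {E ι : Type*} [NormedAddCommGroup E]
    [NormedSpace ℂ E] [Fintype ι] (F : ι → E →L[ℂ] ℂ) {A : ℝ} (hA : 0 ≤ A)
    (h : ∀ g : ι → E, ‖∑ s, F s (g s)‖ ≤ A * √(∑ s, ‖g s‖ ^ 2)) :
    √(∑ s, ‖F s‖ ^ 2) ≤ A := by
  set S := ∑ s, ‖F s‖ ^ 2 with hS
  have hS0 : 0 ≤ S := by positivity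
  have key : ∀ θ : ℝ, 0 ≤ θ → θ < 1 → θ * √S ≤ A := by
    intro θ h0 h1
    choose g hg hFg using fun s => exists_apply_eq_mul_norm_sq (F s) h0 h1
    have h2 := h g
    have h3 : ‖∑ s, F s (g s)‖ = θ * S := by
      simp_rw [hFg]
      rw [← Complex.ofReal_sum, ← Finset.mul_sum, Complex.norm_real,
        Real.norm_of_nonneg (by positivity)]
    have h4 : √(∑ s, ‖g s‖ ^ 2) ≤ √S := by
      apply Real.sqrt_le_sqrt
      apply Finset.sum_le_sum
      intro s _
      have := hg s
      gcongr
    have h5 : θ * S ≤ A * √S := h3 ▸ h2.trans (by gcongr)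
    rcases (Real.sqrt_nonneg S).eq_or_lt with h6 | h6
    · rw [← h6]; simpa using hA
    · nlinarith [Real.mul_self_sqrt hS0]
  refine le_of_forall_lt_imp_le_of_dense fun b hb => ?_
  rcases le_or_gt b 0 with hb0 | hb0
  · exact hb0.trans hA
  have hpos : 0 < √S := hb0.trans hb
  have := key (b / √S) (by positivity) ((div_lt_one hpos).2 hb)
  rwa [div_mul_cancel₀ _ hpos.ne'] at this

/-- Hahn-Banach in a finite `ℓ²`-sum, with the dual of the sum identified. -/
theorem exists_sum_apply_eq_of_norm_le {E V ι : Type*} [NormedAddCommGroup E] [NormedSpace ℂ E]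
    [AddCommGroup V] [Module ℂ V] [Fintype ι] (J : V →ₗ[ℂ] ι → E) (φ : V →ₗ[ℂ] ℂ)
    {A : ℝ} (hA : 0 ≤ A) (h : ∀ x, ‖φ x‖ ≤ A * √(∑ s, ‖J x s‖ ^ 2)) :
    ∃ G : ι → E →L[ℂ] ℂ, √(∑ s, ‖G s‖ ^ 2) ≤ A ∧ ∀ x, φ x = ∑ s, G s (J x s) := by
  classical
  let J' : V →ₗ[ℂ] PiLp 2 (fun _ : ι => E) :=
    (WithLp.linearEquiv 2 ℂ (ι → E)).symm.toLinearMap ∘ₗ J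
  have hJ' : ∀ x, ‖J' x‖ = √(∑ s, ‖J x s‖ ^ 2) := fun x => PiLp.norm_eq_of_L2 _
  have hφ : φ ∈ LinearMap.range J'.dualMap := by
    rw [LinearMap.range_dualMap_eq_dualAnnihilator_ker, Submodule.mem_dualAnnihilator]
    intro x hx
    have h1 := h x
    rw [← hJ', LinearMap.mem_ker.1 hx, norm_zero, mul_zero] at h1
    exact norm_le_zero_iff.1 h1
  obtain ⟨ψ, hψ⟩ := hφ
  have hψ' : ∀ x, ψ (J' x) = φ x := fun x => LinearMap.congr_fun hψ x
  let f : LinearMap.range J' →L[ℂ] ℂ :=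
    (ψ.domRestrict (LinearMap.range J')).mkContinuous A (by
      rintro ⟨_, x, rfl⟩
      change ‖ψ (J' x)‖ ≤ A * ‖J' x‖
      rw [hψ', hJ']
      exact h x)
  obtain ⟨f', hf', hnorm⟩ := exists_extension_norm_eq (LinearMap.range J') f
  have hf : ‖f'‖ ≤ A := hnorm ▸ LinearMap.mkContinuous_norm_le _ hA _
  let c : (ι → E) →L[ℂ] ℂ := f' ∘L (PiLp.continuousLinearEquiv 2 ℂ (fun _ : ι => E)).symm
  have hc : ∀ g : ι → E, ∑ s, c (Pi.single s (g s)) = f' (WithLp.toLp 2 g) := by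
    intro g
    rw [← map_sum, Finset.univ_sum_single]
    rfl
  refine ⟨fun s => c ∘L ContinuousLinearMap.single ℂ (fun _ : ι => E) s, ?_, fun x => ?_⟩
  · refine sqrt_sum_norm_sq_le_of_norm_sum_apply_le _ hA fun g => ?_
    change ‖∑ s, c (Pi.single s (g s))‖ ≤ _
    rw [hc, ← PiLp.norm_eq_of_L2 (WithLp.toLp 2 g)]
    exact f'.le_of_opNorm_le hf _
  · change _ = ∑ s, c (Pi.single s (J x s))
    rw [hc, ← hψ']
    exact (hf' ⟨J' x, x, rfl⟩).symm

/-- The sign `±1` encoded by a Boolean. -/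
def boolSign (b : Bool) : ℂ := if b then 1 else -1

theorem radNorm_le_mul_iff {X Y : Type*} [NormedAddCommGroup X] [NormedSpace ℂ X]
    [NormedAddCommGroup Y] [NormedSpace ℂ Y] {n : ℕ} {x : Fin n → X} {y : Fin n → Y} {C : ℝ} :
    radNorm x ≤ C * radNorm y ↔
      √(∑ s : Fin n → Bool, ‖∑ k, boolSign (s k) • x k‖ ^ 2) ≤
        C * √(∑ s : Fin n → Bool, ‖∑ k, boolSign (s k) • y k‖ ^ 2) := by
  have h : (0 : ℝ) < √(2 ^ n) := by positivity
  unfold radNorm boolSign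
  rw [Real.sqrt_div' _ (by positivity), Real.sqrt_div' _ (by positivity), ← mul_div_assoc,
    div_le_div_iff_of_pos_right h]

theorem radNorm_linearIsometry {X Y : Type*} [NormedAddCommGroup X] [NormedSpace ℂ X]
    [NormedAddCommGroup Y] [NormedSpace ℂ Y] (f : X →ₗᵢ[ℂ] Y) {n : ℕ} (x : Fin n → X) :
    radNorm (fun k => f (x k)) = radNorm x := by
  unfold radNorm
  simp_rw [← map_smul, ← map_sum, f.norm_map]

theorem IsRBoundedWith.of_bidual {X : Type*} [NormedAddCommGroup X] [NormedSpace ℂ X] {C : ℝ}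
    {τ : Set (X →L[ℂ] X)}
    (h : IsRBoundedWith (X := (X →L[ℂ] ℂ) →L[ℂ] ℂ) C ((fun T => bidualCLM T) '' τ)) :
    IsRBoundedWith C τ := by
  refine ⟨h.1, fun n T x hT => ?_⟩
  have h1 := h.2 n (fun k => bidualCLM (T k))
    (fun k => NormedSpace.inclusionInDoubleDualLi ℂ (x k)) fun k => ⟨T k, hT k, rfl⟩
  have hx := radNorm_linearIsometry (Y := (X →L[ℂ] ℂ) →L[ℂ] ℂ)
    (NormedSpace.inclusionInDoubleDualLi (E := X) ℂ) x
  have hTx := radNorm_linearIsometry (Y := (X →L[ℂ] ℂ) →L[ℂ] ℂ)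
    (NormedSpace.inclusionInDoubleDualLi (E := X) ℂ)
    fun k => T k (x k)
  exact (hTx.ge.trans h1).trans (mul_le_mul_of_nonneg_left hx.le h.1)

theorem radNorm_bidualCLM_le {X : Type*} [NormedAddCommGroup X] [NormedSpace ℂ X] {C : ℝ}
    (hC : 0 ≤ C) {n : ℕ} (T : Fin n → X →L[ℂ] X)
    (h : ∀ x : Fin n → X, radNorm (fun k => T k (x k)) ≤ C * radNorm x)
    (z : Fin n → (X →L[ℂ] ℂ) →L[ℂ] ℂ) :
    radNorm (fun k => bidualCLM (T k) (z k)) ≤ C * radNorm z := by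
  rw [radNorm_le_mul_iff]
  refine sqrt_sum_norm_sq_le_of_norm_sum_apply_le _ (by positivity) fun g => ?_
  let J : (Fin n → X) →ₗ[ℂ] (Fin n → Bool) → X :=
    LinearMap.pi fun s => ∑ k, boolSign (s k) • LinearMap.proj k
  have hJ : ∀ x s, J x s = ∑ k, boolSign (s k) • x k := fun x s => by simp [J]
  let D : (Fin n → X) →ₗ[ℂ] Fin n → X :=
    LinearMap.pi fun k => (T k).toLinearMap ∘ₗ LinearMap.proj k
  have hD : ∀ x k, D x k = T k (x k) := fun x k => rfl
  let φ : (Fin n → X) →ₗ[ℂ] ℂ :=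
    ∑ s, (g s).toLinearMap ∘ₗ LinearMap.proj s ∘ₗ J ∘ₗ D
  have hφ : ∀ x, φ x = ∑ s, g s (J (D x) s) := fun x => by simp [φ]
  obtain ⟨G, hG, hGφ⟩ := exists_sum_apply_eq_of_norm_le J φ
      (A := √(∑ s, ‖g s‖ ^ 2) * C) (by positivity) fun x => by
    rw [hφ, mul_assoc]
    refine (norm_sum_apply_le g _).trans ?_
    gcongr
    simp_rw [hJ]
    exact radNorm_le_mul_iff.1 (h x)
  have hdual : ∀ k, dualCLM (T k) (∑ s, boolSign (s k) • g s) = ∑ s, boolSign (s k) • G s := by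
    intro k
    ext v
    have h1 := hGφ (Pi.single k v)
    have h2 : ∀ s, J (D (Pi.single k v)) s = boolSign (s k) • T k v := by
      intro s
      rw [hJ, Finset.sum_eq_single k]
      · rw [hD, Pi.single_eq_same]
      · intro j _ hj
        rw [hD, Pi.single_eq_of_ne hj, map_zero, smul_zero]
      · simp
    have h3 : ∀ s, J (Pi.single k v) s = boolSign (s k) • v := by
      intro s
      rw [hJ, Finset.sum_eq_single k]
      · rw [Pi.single_eq_same]
      · intro j _ hj
        rw [Pi.single_eq_of_ne hj, smul_zero]
      · simp
    rw [hφ] at h1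
    simp_rw [h2, h3, map_smul] at h1
    change (∑ s, boolSign (s k) • g s) (T k v) = _
    simpa [_root_.sum_apply] using h1
  have hswap : ∑ s, (∑ k, boolSign (s k) • bidualCLM (T k) (z k)) (g s) =
      ∑ s, (∑ k, boolSign (s k) • z k) (G s) := by
    have hb : ∀ k w, bidualCLM (T k) (z k) w = z k (dualCLM (T k) w) := fun _ _ => rfl
    simp_rw [_root_.sum_apply, _root_.smul_apply, ← map_smul]
    rw [Finset.sum_comm, Finset.sum_comm (s := univ (α := Fin n → Bool))]
    refine Finset.sum_congr rfl fun k _ => ?_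
    rw [← map_sum, ← map_sum, hb, hdual]
  rw [hswap]
  refine (norm_sum_apply_le _ G).trans ?_
  calc _ ≤ √(∑ s : Fin n → Bool, ‖∑ k, boolSign (s k) • z k‖ ^ 2) *
        (√(∑ s, ‖g s‖ ^ 2) * C) := by gcongr
    _ = _ := by ring

theorem IsRBoundedWith.bidual {X : Type*} [NormedAddCommGroup X] [NormedSpace ℂ X] {C : ℝ}
    {τ : Set (X →L[ℂ] X)} (h : IsRBoundedWith C τ) :
    IsRBoundedWith (X := (X →L[ℂ] ℂ) →L[ℂ] ℂ) C ((fun T => bidualCLM T) '' τ) := by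
  refine ⟨h.1, fun n S z hS => ?_⟩
  choose T hT hTS using hS
  obtain rfl : (fun k => bidualCLM (T k)) = S := funext hTS
  exact radNorm_bidualCLM_le h.1 T (fun x => h.2 n T x hT) z

theorem isRBoundedWith_bidual_iff {X : Type*} [NormedAddCommGroup X] [NormedSpace ℂ X] {C : ℝ}
    {τ : Set (X →L[ℂ] X)} :
    IsRBoundedWith (X := (X →L[ℂ] ℂ) →L[ℂ] ℂ) C ((fun T => bidualCLM T) '' τ) ↔
      IsRBoundedWith C τ :=
  ⟨.of_bidual, .bidual⟩

/-- `τ` is `R`-bounded iff `τ** = {T** : T ∈ τ}` is `R`-bounded, and in this case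
`R(τ) = R(τ**)`. -/
theorem rBounded_iff_bidual_rBounded {X : Type*} [NormedAddCommGroup X]
    [NormedSpace ℂ X] (τ : Set (X →L[ℂ] X)) :
    ((∃ C, IsRBoundedWith C τ) ↔ ∃ C, IsRBoundedWith (X := (X →L[ℂ] ℂ) →L[ℂ] ℂ) C ((fun T => bidualCLM T) '' τ)) ∧
    ((∃ C, IsRBoundedWith C τ) → RBound τ = RBound (X := (X →L[ℂ] ℂ) →L[ℂ] ℂ) ((fun T => bidualCLM T) '' τ)) := by
  simp [RBound, isRBoundedWith_bidual_iff]
end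

section
/- Let K be compact, X a Banach space, and u : C(K) → B(X) a bounded unital algebra homomorphism. Then for any finite families f_1,...,f_n ∈ C(K) and b_1,...,b_n ∈ B(X) with each b_k commuting with the range of u, we have ‖Σ_k u(f_k) b_k‖ ≤ ‖u‖² · R({Σ_k f_k(t) b_k : t ∈ K}). -/
open Finset

/-- A pair of complementary truncated ramps with disjoint supports `x < 1 / 2` (for `true`) and
`1 / 2 < x` (for `false`); outside `(0, 1)` one of the two equals `1`. -/
noncomputable def ramp (b : Bool) (x : ℝ) : ℝ :=
  max 0 (min 1 (if b then 1 - 2 * x else 2 * x - 1))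

lemma continuous_ramp (b : Bool) : Continuous (ramp b) := by
  unfold ramp
  split_ifs <;> fun_prop

lemma ramp_nonneg (b : Bool) (x : ℝ) : 0 ≤ ramp b x := le_max_left _ _

lemma ramp_le_one (b : Bool) (x : ℝ) : ramp b x ≤ 1 :=
  max_le zero_le_one (min_le_left _ _)

lemma ramp_true_eq_zero {x : ℝ} (hx : 1 / 2 ≤ x) : ramp true x = 0 := by
  simp only [ramp, if_true]
  exact max_eq_left ((min_le_right _ _).trans (by linarith))

lemma ramp_false_eq_zero {x : ℝ} (hx : x ≤ 1 / 2) : ramp false x = 0 := by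
  simp only [ramp, Bool.false_eq_true, if_false]
  exact max_eq_left ((min_le_right _ _).trans (by linarith))

lemma ramp_true_eq_one {x : ℝ} (hx : x ≤ 0) : ramp true x = 1 := by
  simp only [ramp, if_true]
  rw [min_eq_left (by linarith), max_eq_right zero_le_one]

lemma ramp_false_eq_one {x : ℝ} (hx : 1 ≤ x) : ramp false x = 1 := by
  simp only [ramp, Bool.false_eq_true, if_false]
  rw [min_eq_left (by linarith), max_eq_right zero_le_one]

lemma ramp_mul_ramp_of_ne {b c : Bool} (h : b ≠ c) (x : ℝ) : ramp b x * ramp c x = 0 := by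
  rcases le_total x (1 / 2) with hx | hx
  · cases b <;> cases c <;> simp_all [ramp_false_eq_zero]
  · cases b <;> cases c <;> simp_all [ramp_true_eq_zero]

lemma sum_ramp_sq_nonneg (x : ℝ) : 0 ≤ ∑ b, ramp b x ^ 2 :=
  sum_nonneg fun _ _ => sq_nonneg _

lemma sum_ramp_sq_le_one (x : ℝ) : ∑ b, ramp b x ^ 2 ≤ 1 := by
  rw [Fintype.sum_bool]
  rcases le_total x (1 / 2) with hx | hx
  · rw [ramp_false_eq_zero hx]
    have := pow_le_one₀ (n := 2) (ramp_nonneg true x) (ramp_le_one true x)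
    linarith
  · rw [ramp_true_eq_zero hx]
    have := pow_le_one₀ (n := 2) (ramp_nonneg false x) (ramp_le_one false x)
    linarith

lemma sum_ramp_sq_eq_one {x : ℝ} (hx : ¬ (0 < x ∧ x < 1)) : ∑ b, ramp b x ^ 2 = 1 := by
  rw [Fintype.sum_bool]
  rcases le_or_gt x 0 with h | h
  · rw [ramp_true_eq_one h, ramp_false_eq_zero (by linarith)]; norm_num
  · have h1 : 1 ≤ x := by
      by_contra! h1
      exact hx ⟨h, h1⟩
    rw [ramp_false_eq_one h1, ramp_true_eq_zero (by linarith)]; norm_num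

lemma sum_one_sub_ramp_sq_le_one (M : ℕ) (x : ℝ) :
    ∑ m : Fin M, (1 - ∑ b, ramp b (x - m) ^ 2) ≤ 1 := by
  rw [Fin.sum_univ_eq_sum_range (fun m : ℕ => 1 - ∑ b, ramp b (x - m) ^ 2) M]
  calc ∑ m ∈ range M, (1 - ∑ b, ramp b (x - m) ^ 2)
      ≤ ∑ m ∈ range M, if m = ⌊x⌋₊ then (1 : ℝ) else 0 := by
        refine sum_le_sum fun m _ => ?_
        split_ifs with h
        · linarith [sum_ramp_sq_nonneg (x - m)]
        · rw [sum_ramp_sq_eq_one, sub_self]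
          rintro ⟨h0, h1⟩
          refine h (Eq.symm ?_)
          rw [Nat.floor_eq_iff (by linarith [Nat.cast_nonneg (α := ℝ) m])]
          exact ⟨by linarith, by linarith⟩
    _ ≤ 1 := by
        rw [sum_ite_eq']
        split_ifs <;> norm_num

lemma one_sub_prod_le_sum_one_sub {ι : Type*} (s : Finset ι) (a : ι → ℝ)
    (h0 : ∀ i, 0 ≤ a i) (h1 : ∀ i, a i ≤ 1) : 1 - ∏ i ∈ s, a i ≤ ∑ i ∈ s, (1 - a i) := by
  classical
  induction s using Finset.induction_on with
  | empty => simp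
  | insert i s hi ih =>
    rw [prod_insert hi, sum_insert hi]
    have hp : ∏ i ∈ s, a i ≤ 1 := prod_le_one (fun i _ => h0 i) fun i _ => h1 i
    nlinarith [mul_nonneg (sub_nonneg.2 (h1 i)) (sub_nonneg.2 hp)]

/-- The bump function attached to the pattern `A`, at a point with coordinates `y`: it singles out
the region where `y j` is below a threshold in `(1, 2)` exactly for those `j` with `A j = true`.
The parameter `m < M` selects the threshold. -/
noncomputable def cellBump {N : ℕ} (M m : ℕ) (A : Fin N → Bool) (y : Fin N → ℝ) : ℝ :=
  ∏ j, ramp (A j) (M * (y j - 1) - m)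

section cellBump

variable {N : ℕ} (M m : ℕ) (A : Fin N → Bool) (y : Fin N → ℝ)

lemma continuous_cellBump : Continuous (cellBump M m A) :=
  continuous_finsetProd _ fun j _ => (continuous_ramp (A j)).comp (by fun_prop)

lemma cellBump_nonneg : 0 ≤ cellBump M m A y := prod_nonneg fun _ _ => ramp_nonneg _ _

lemma cellBump_le_one : cellBump M m A y ≤ 1 :=
  prod_le_one (fun _ _ => ramp_nonneg _ _) fun _ _ => ramp_le_one _ _

lemma cellBump_mul_of_ne {A B : Fin N → Bool} (h : A ≠ B) :
    cellBump M m A y * cellBump M m B y = 0 := by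
  obtain ⟨j, hj⟩ := Function.ne_iff.1 h
  rw [cellBump, cellBump, ← prod_mul_distrib]
  exact prod_eq_zero (mem_univ j) (ramp_mul_ramp_of_ne hj _)

lemma sum_cellBump_sq :
    ∑ A, cellBump M m A y ^ 2 = ∏ j, ∑ b, ramp b (M * (y j - 1) - m) ^ 2 := by
  simp only [Fintype.prod_sum, cellBump, prod_pow]

lemma sum_cellBump_sq_le_one : ∑ A, cellBump M m A y ^ 2 ≤ 1 := by
  rw [sum_cellBump_sq]
  exact prod_le_one (fun _ _ => sum_ramp_sq_nonneg _) fun _ _ => sum_ramp_sq_le_one _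

lemma sum_one_sub_cellBump_sq_le :
    ∑ m : Fin M, (1 - ∑ A, cellBump M m A y ^ 2) ≤ N := by
  calc ∑ m : Fin M, (1 - ∑ A, cellBump M m A y ^ 2)
      ≤ ∑ m : Fin M, ∑ j, (1 - ∑ b, ramp b (M * (y j - 1) - m) ^ 2) := by
        refine sum_le_sum fun m _ => ?_
        rw [sum_cellBump_sq]
        exact one_sub_prod_le_sum_one_sub _ _ (fun _ => sum_ramp_sq_nonneg _)
          fun _ => sum_ramp_sq_le_one _
    _ = ∑ j, ∑ m : Fin M, (1 - ∑ b, ramp b (M * (y j - 1) - m) ^ 2) := sum_comm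
    _ ≤ ∑ j : Fin N, (1 : ℝ) := sum_le_sum fun j _ => sum_one_sub_ramp_sq_le_one M _
    _ = N := by simp

variable {M m A y}

lemma lt_two_of_cellBump_ne_zero (hm : m < M) (hA : cellBump M m A y ≠ 0) {j : Fin N}
    (hj : A j = true) : y j < 2 := by
  have h := prod_ne_zero_iff.1 hA j (mem_univ j)
  by_contra! h2
  refine h ?_
  rw [hj]
  refine ramp_true_eq_zero ?_
  have hm' : (m : ℝ) + 1 ≤ M := by exact_mod_cast hm
  have : (0 : ℝ) ≤ M := Nat.cast_nonneg M
  nlinarith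

lemma exists_eq_true_of_cellBump_ne_zero (hA : cellBump M m A y ≠ 0) (hy : ∃ j, y j < 1) :
    ∃ j, A j = true := by
  obtain ⟨j, hj⟩ := hy
  refine ⟨j, ?_⟩
  have h := prod_ne_zero_iff.1 hA j (mem_univ j)
  by_contra hAj
  rw [Bool.not_eq_true] at hAj
  refine h ?_
  rw [hAj]
  refine ramp_false_eq_zero ?_
  have : (0 : ℝ) ≤ M := Nat.cast_nonneg M
  have : (0 : ℝ) ≤ m := Nat.cast_nonneg m
  nlinarith

end cellBump

lemma norm_sum_sign_smul_le_one {ι : Type*} [Fintype ι] (a : ι → ℂ) (ha : ∀ i, ‖a i‖ ≤ 1)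
    (hdisj : ∀ i j, i ≠ j → a i * a j = 0) (s : ι → Bool) :
    ‖∑ i, (if s i then (1 : ℂ) else -1) • a i‖ ≤ 1 := by
  by_cases h : ∃ i, a i ≠ 0
  · obtain ⟨i, hi⟩ := h
    rw [Fintype.sum_eq_single i]
    · rw [norm_smul]
      split_ifs <;> simpa using ha i
    · intro j hj
      rw [(mul_eq_zero.1 (hdisj j i hj)).resolve_right hi, smul_zero]
  · push Not at h
    simp [h]

/-- Finitely many continuous functions on a compact space are uniformly approximated by averages
of step-like functions built on families of functions with pairwise disjoint supports. -/
lemma exists_average_disjoint_approx {K : Type*} [TopologicalSpace K] [CompactSpace K] [Nonempty K]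
    {n : ℕ} (f : Fin n → C(K, ℂ)) {ε : ℝ} (hε : 0 < ε) :
    ∃ (M N : ℕ) (ψ : Fin M → (Fin N → Bool) → C(K, ℂ)) (t : Fin M → (Fin N → Bool) → K), 0 < M ∧
      (∀ m (s : (Fin N → Bool) → Bool), ‖∑ A, (if s A then (1 : ℂ) else -1) • ψ m A‖ ≤ 1) ∧
      ∀ k, ‖(M : ℂ) • f k - ∑ m, ∑ A, f k (t m A) • (ψ m A * ψ m A)‖ ≤ M * ε := by
  classical
  obtain ⟨δ, hδ, hδε⟩ : ∃ δ : ℝ, 0 < δ ∧ 4 * δ = ε / 2 := ⟨ε / 8, by linarith, by ring⟩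
  let F : K → Fin n → ℂ := fun t k => f k t
  have hF : Continuous F := by fun_prop
  obtain ⟨c, hc⟩ := isCompact_univ.elim_nhds_subcover (fun t : K => F ⁻¹' Metric.ball (F t) δ)
    fun t _ => hF.continuousAt.preimage_mem_nhds (Metric.ball_mem_nhds _ hδ)
  let p : Fin c.card → K := fun j => c.equivFin.symm j
  have hp : ∀ t, ∃ j, dist (F t) (F (p j)) < δ := by
    intro t
    obtain ⟨x, hx, hxt⟩ := Set.mem_iUnion₂.1 (hc.2 (Set.mem_univ t))
    exact ⟨c.equivFin ⟨x, hx⟩, by simpa [p] using hxt⟩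
  let y : K → Fin c.card → ℝ := fun t j => dist (F t) (F (p j)) / δ
  have hy : Continuous y := by fun_prop
  have hy1 : ∀ t, ∃ j, y t j < 1 := fun t => by
    obtain ⟨j, hj⟩ := hp t
    exact ⟨j, (div_lt_one hδ).2 hj⟩
  obtain ⟨R, hR⟩ : ∃ R : ℝ, ∀ k, ‖f k‖ ≤ R := by
    refine ⟨∑ k, ‖f k‖, fun k => ?_⟩
    exact single_le_sum (f := fun k => ‖f k‖) (fun _ _ => norm_nonneg _) (mem_univ k)
  obtain ⟨M, hM⟩ := exists_nat_gt (max 0 (c.card * R / (ε / 2)))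
  have hM0 : (0 : ℝ) < M := (le_max_left _ _).trans_lt hM
  have hMR : c.card * R ≤ M * (ε / 2) :=
    ((div_lt_iff₀ (by linarith)).1 ((le_max_right _ _).trans_lt hM)).le
  let ψ : Fin M → (Fin c.card → Bool) → C(K, ℂ) := fun m A =>
    ⟨fun t => (cellBump M m A (y t) : ℂ),
      Complex.continuous_ofReal.comp ((continuous_cellBump M m A).comp hy)⟩
  have hψ : ∀ m A t, ψ m A t = (cellBump M m A (y t) : ℂ) := fun _ _ _ => rfl
  have hosc : ∀ (m : Fin M) (A : Fin c.card → Bool), ∃ t₀, ∀ t, cellBump M m A (y t) ≠ 0 →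
      ∀ k, ‖f k t - f k t₀‖ ≤ 4 * δ := by
    intro m A
    by_cases h : ∃ t₀, cellBump M m A (y t₀) ≠ 0
    · obtain ⟨t₀, ht₀⟩ := h
      refine ⟨t₀, fun t ht k => ?_⟩
      obtain ⟨j, hj⟩ := exists_eq_true_of_cellBump_ne_zero ht₀ (hy1 t₀)
      have h1 := (div_lt_iff₀ hδ).1 (lt_two_of_cellBump_ne_zero m.2 ht hj)
      have h2 := (div_lt_iff₀ hδ).1 (lt_two_of_cellBump_ne_zero m.2 ht₀ hj)
      have h3 := dist_le_pi_dist (F t) (F t₀) k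
      rw [dist_eq_norm] at h3
      have h4 := dist_triangle_right (F t) (F t₀) (F (p j))
      change ‖f k t - f k t₀‖ ≤ _ at h3
      linarith
    · push Not at h
      exact ⟨Classical.arbitrary K, fun t ht => absurd (h t) ht⟩
  choose t₀ ht₀ using hosc
  refine ⟨M, c.card, ψ, t₀, by exact_mod_cast hM0, fun m s => ?_, fun k => ?_⟩
  · rw [ContinuousMap.norm_le _ zero_le_one]
    intro t
    have h := norm_sum_sign_smul_le_one (fun A => ψ m A t) (fun A => ?_) (fun A B hAB => ?_) s
    · simpa only [ContinuousMap.sum_apply, ContinuousMap.smul_apply] using h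
    · rw [hψ, Complex.norm_real, Real.norm_of_nonneg (cellBump_nonneg _ _ _ _)]
      exact cellBump_le_one _ _ _ _
    · rw [hψ, hψ, ← Complex.ofReal_mul, cellBump_mul_of_ne _ _ _ hAB, Complex.ofReal_zero]
  · rw [ContinuousMap.norm_le _ (by positivity)]
    intro t
    set g : Fin M → (Fin c.card → Bool) → ℝ := fun m A => cellBump M m A (y t) ^ 2 with hg
    have hg0 : ∀ m A, 0 ≤ g m A := fun m A => sq_nonneg _
    have hg1 : ∀ m, ∑ A, g m A ≤ 1 := fun m => sum_cellBump_sq_le_one M m (y t)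
    have hval : ((M : ℂ) • f k - ∑ m, ∑ A, f k (t₀ m A) • (ψ m A * ψ m A)) t =
        ∑ m, (((1 - ∑ A, g m A : ℝ) : ℂ) * f k t +
          ∑ A, (g m A : ℂ) * (f k t - f k (t₀ m A))) := by
      have : (M : ℂ) * f k t = ∑ m : Fin M, f k t := by simp
      simp only [ContinuousMap.sub_apply, ContinuousMap.smul_apply, ContinuousMap.sum_apply,
        ContinuousMap.mul_apply, smul_eq_mul, hψ]
      rw [this, ← sum_sub_distrib]
      refine sum_congr rfl fun m _ => ?_
      simp only [mul_sub, sum_sub_distrib, ← sum_mul, hg]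
      push_cast
      rw [sub_mul, one_mul, sub_add_sub_cancel]
      congr 1
      exact sum_congr rfl fun A _ => by ring
    rw [hval]
    calc ‖∑ m, (((1 - ∑ A, g m A : ℝ) : ℂ) * f k t +
          ∑ A, (g m A : ℂ) * (f k t - f k (t₀ m A)))‖
        ≤ ∑ m, ((1 - ∑ A, g m A) * R + 4 * δ) := by
          refine norm_sum_le_of_le _ fun m _ => (norm_add_le _ _).trans (add_le_add ?_ ?_)
          · rw [norm_mul, Complex.norm_real, Real.norm_of_nonneg (sub_nonneg.2 (hg1 m))]
            exact mul_le_mul_of_nonneg_left (((f k).norm_coe_le_norm t).trans (hR k))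
              (sub_nonneg.2 (hg1 m))
          · calc ‖∑ A, (g m A : ℂ) * (f k t - f k (t₀ m A))‖ ≤ ∑ A, g m A * (4 * δ) := by
                  refine norm_sum_le_of_le _ fun A _ => ?_
                  rw [norm_mul, Complex.norm_real, Real.norm_of_nonneg (hg0 m A)]
                  by_cases h : cellBump M m A (y t) = 0
                  · simp [hg, h]
                  · exact mul_le_mul_of_nonneg_left (ht₀ m A t h k) (hg0 m A)
              _ ≤ 4 * δ := by
                  rw [← sum_mul]
                  exact mul_le_of_le_one_left (by linarith) (hg1 m)
      _ = (∑ m, (1 - ∑ A, g m A)) * R + M * (4 * δ) := by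
          rw [sum_add_distrib, sum_mul]; simp
      _ ≤ c.card * R + M * (4 * δ) := by
          have hR0 : 0 ≤ R := (norm_nonneg _).trans (hR k)
          gcongr
          exact sum_one_sub_cellBump_sq_le M (y t)
      _ ≤ M * ε := by rw [hδε]; linarith

lemma sum_sign_mul_sign {n : ℕ} (i j : Fin n) :
    ∑ s : Fin n → Bool, (if s i then (1 : ℂ) else -1) * (if s j then (1 : ℂ) else -1) =
      if i = j then 2 ^ n else 0 := by
  split_ifs with h
  · subst h
    rw [sum_congr rfl (g := fun _ => (1 : ℂ)) fun s _ => by split_ifs <;> norm_num]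
    simp
  · have hinv : Function.Involutive fun s : Fin n → Bool => Function.update s i (!s i) := by
      intro s
      simp
    have hsum := hinv.toPerm.sum_comp univ (fun s : Fin n → Bool =>
      (if s i then (1 : ℂ) else -1) * (if s j then (1 : ℂ) else -1)) (by simp)
    rw [← self_eq_neg, ← sum_neg_distrib]
    nth_rewrite 1 [← hsum]
    refine sum_congr rfl fun s _ => ?_
    simp only [Function.Involutive.coe_toPerm, Function.update_self,
      Function.update_of_ne (Ne.symm h)]
    cases s i <;> cases s j <;> simp

/-- Decoupling of a diagonal sum as a Rademacher average. -/
lemma sum_sum_sign_smul_apply {X : Type*} [NormedAddCommGroup X] [NormedSpace ℂ X] {n : ℕ}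
    (V : Fin n → X →L[ℂ] X) (x : Fin n → X) :
    ∑ s : Fin n → Bool, (∑ i, (if s i then (1 : ℂ) else -1) • V i)
        (∑ j, (if s j then (1 : ℂ) else -1) • x j) = (2 ^ n : ℂ) • ∑ i, V i (x i) := by
  simp only [_root_.sum_apply, smul_apply, map_sum, map_smul,
    smul_sum, smul_smul]
  rw [sum_comm]
  refine sum_congr rfl fun i _ => ?_
  rw [sum_comm]
  simp only [← sum_smul, sum_sign_mul_sign, ite_smul, zero_smul]
  simp

lemma radNorm_le_of_forall {X : Type*} [NormedAddCommGroup X] [NormedSpace ℂ X] {n : ℕ}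
    {x : Fin n → X} {B : ℝ} (hB : 0 ≤ B)
    (h : ∀ s : Fin n → Bool, ‖∑ k, (if s k then (1 : ℂ) else -1) • x k‖ ≤ B) :
    radNorm x ≤ B := by
  refine Real.sqrt_le_iff.2 ⟨hB, ?_⟩
  rw [div_le_iff₀ (by positivity)]
  calc ∑ s : Fin n → Bool, ‖∑ k, (if s k then (1 : ℂ) else -1) • x k‖ ^ 2
      ≤ ∑ s : Fin n → Bool, B ^ 2 := sum_le_sum fun s _ => by gcongr; exact h s
    _ = B ^ 2 * 2 ^ n := by simp [mul_comm]

lemma sum_norm_sign_smul_le_radNorm {X : Type*} [NormedAddCommGroup X] [NormedSpace ℂ X] {n : ℕ}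
    (x : Fin n → X) :
    ∑ s : Fin n → Bool, ‖∑ k, (if s k then (1 : ℂ) else -1) • x k‖ ≤ 2 ^ n * radNorm x := by
  rw [← div_le_iff₀' (by positivity)]
  refine Real.le_sqrt_of_sq_le ?_
  have h := sq_sum_le_card_mul_sum_sq (s := (univ : Finset (Fin n → Bool)))
    (f := fun s => ‖∑ k, (if s k then (1 : ℂ) else -1) • x k‖)
  have hcard : ((univ : Finset (Fin n → Bool)).card : ℝ) = 2 ^ n := by simp
  rw [hcard] at h
  rw [div_pow, div_le_div_iff₀ (by positivity) (by positivity)]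
  have h2 : (0 : ℝ) ≤ 2 ^ n := by positivity
  nlinarith [mul_le_mul_of_nonneg_right h h2]

lemma norm_sum_conj_le_of_fin {K : Type*} [TopologicalSpace K] [CompactSpace K]
    {X : Type*} [NormedAddCommGroup X] [NormedSpace ℂ X]
    (u : C(K, ℂ) →L[ℂ] (X →L[ℂ] X)) {C : ℝ} {τ : Set (X →L[ℂ] X)} (hC : IsRBoundedWith C τ)
    {n : ℕ} (ψ : Fin n → C(K, ℂ)) (T : Fin n → X →L[ℂ] X) (hT : ∀ i, T i ∈ τ)
    (hψ : ∀ s : Fin n → Bool, ‖∑ i, (if s i then (1 : ℂ) else -1) • ψ i‖ ≤ 1) :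
    ‖∑ i, u (ψ i) * T i * u (ψ i)‖ ≤ ‖u‖ ^ 2 * C := by
  have hC0 := hC.1
  have hu : ∀ s : Fin n → Bool, ‖∑ i, (if s i then (1 : ℂ) else -1) • u (ψ i)‖ ≤ ‖u‖ := by
    intro s
    have h : ∑ i, (if s i then (1 : ℂ) else -1) • u (ψ i) =
        u (∑ i, (if s i then (1 : ℂ) else -1) • ψ i) := by
      simp only [map_sum, map_smul]
    rw [h]
    exact (u.le_opNorm _).trans (mul_le_of_le_one_right (norm_nonneg _) (hψ s))
  refine ContinuousLinearMap.opNorm_le_bound _ (by positivity) fun x => ?_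
  have hrad : radNorm (fun i => u (ψ i) x) ≤ ‖u‖ * ‖x‖ := by
    refine radNorm_le_of_forall (by positivity) fun s => ?_
    have h := (∑ i, (if s i then (1 : ℂ) else -1) • u (ψ i)).le_of_opNorm_le (hu s) x
    simpa only [_root_.sum_apply, smul_apply] using h
  have hdec := sum_sum_sign_smul_apply (fun i => u (ψ i)) fun i => T i (u (ψ i) x)
  have happ : (∑ i, u (ψ i) * T i * u (ψ i)) x = ∑ i, u (ψ i) (T i (u (ψ i) x)) := by
    simp
  rw [happ]
  have h2 : (0 : ℝ) < 2 ^ n := by positivity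
  refine le_of_mul_le_mul_left ?_ h2
  calc (2 : ℝ) ^ n * ‖∑ i, u (ψ i) (T i (u (ψ i) x))‖
      = ‖(2 ^ n : ℂ) • ∑ i, u (ψ i) (T i (u (ψ i) x))‖ := by simp [norm_smul]
    _ ≤ ∑ s : Fin n → Bool,
          ‖u‖ * ‖∑ j, (if s j then (1 : ℂ) else -1) • T j (u (ψ j) x)‖ := by
        rw [← hdec]
        exact norm_sum_le_of_le _ fun s _ =>
          ContinuousLinearMap.le_of_opNorm_le _ (hu s) _
    _ ≤ ‖u‖ * (2 ^ n * radNorm fun i => T i (u (ψ i) x)) := by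
        rw [← mul_sum]
        gcongr
        exact sum_norm_sign_smul_le_radNorm _
    _ ≤ ‖u‖ * (2 ^ n * (C * (‖u‖ * ‖x‖))) := by
        gcongr
        exact (hC.2 n T _ hT).trans (mul_le_mul_of_nonneg_left hrad hC0)
    _ = 2 ^ n * (‖u‖ ^ 2 * C * ‖x‖) := by ring

lemma norm_sum_conj_le {K : Type*} [TopologicalSpace K] [CompactSpace K]
    {X : Type*} [NormedAddCommGroup X] [NormedSpace ℂ X]
    (u : C(K, ℂ) →L[ℂ] (X →L[ℂ] X)) {C : ℝ} {τ : Set (X →L[ℂ] X)} (hC : IsRBoundedWith C τ)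
    {ι : Type*} [Fintype ι] (ψ : ι → C(K, ℂ)) (T : ι → X →L[ℂ] X) (hT : ∀ i, T i ∈ τ)
    (hψ : ∀ s : ι → Bool, ‖∑ i, (if s i then (1 : ℂ) else -1) • ψ i‖ ≤ 1) :
    ‖∑ i, u (ψ i) * T i * u (ψ i)‖ ≤ ‖u‖ ^ 2 * C := by
  let e := Fintype.equivFin ι
  rw [← e.symm.sum_comp]
  refine norm_sum_conj_le_of_fin u hC (fun i => ψ (e.symm i)) (fun i => T (e.symm i))
    (fun i => hT _) fun s => ?_
  have h := hψ fun i => s (e i)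
  rw [← e.symm.sum_comp] at h
  simpa only [Equiv.apply_symm_apply] using h

/-- Let `u : C(K) → B(X)` be a bounded unital algebra homomorphism, `f_1, …, f_n ∈ C(K)`
and `b_1, …, b_n` operators commuting with the range of `u`. Then
`‖Σ_k u(f_k) b_k‖ ≤ ‖u‖² R({Σ_k f_k(t) b_k : t ∈ K})`. -/
theorem norm_sum_rep_comp_le {K : Type*} [TopologicalSpace K] [CompactSpace K]
    {X : Type*} [NormedAddCommGroup X] [NormedSpace ℂ X] [CompleteSpace X]
    (u : C(K, ℂ) →L[ℂ] (X →L[ℂ] X))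
    (hu_one : u 1 = 1) (hu_mul : ∀ f g : C(K, ℂ), u (f * g) = u f * u g)
    {n : ℕ} (f : Fin n → C(K, ℂ)) (b : Fin n → X →L[ℂ] X)
    (hb : ∀ (k : Fin n) (g : C(K, ℂ)), b k * u g = u g * b k)
    (C : ℝ)
    (hC : IsRBoundedWith C {T : X →L[ℂ] X | ∃ t : K, T = ∑ k, f k t • b k}) :
    ‖∑ k, u (f k) ∘L b k‖ ≤ ‖u‖ ^ 2 * C := by
  rcases isEmpty_or_nonempty K with hK | hK
  · have h0 : ∀ k, f k = 0 := fun k => ContinuousMap.ext fun t => hK.elim t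
    simp [h0]
  have hmain : ∀ ε : ℝ, 0 < ε →
      ‖∑ k, u (f k) ∘L b k‖ ≤ ‖u‖ ^ 2 * C + ε * ∑ k, ‖u‖ * ‖b k‖ := by
    intro ε hε
    obtain ⟨M, N, ψ, t, hM, hψ, happrox⟩ := exists_average_disjoint_approx f hε
    have hM' : (0 : ℝ) < M := by exact_mod_cast hM
    let T : Fin M → (Fin N → Bool) → X →L[ℂ] X := fun m A => ∑ k, f k (t m A) • b k
    have hdecomp : (M : ℂ) • ∑ k, u (f k) ∘L b k =
        ∑ m, ∑ A, u (ψ m A) * T m A * u (ψ m A) +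
          ∑ k, u ((M : ℂ) • f k - ∑ m, ∑ A, f k (t m A) • (ψ m A * ψ m A)) * b k := by
      have h1 : ∀ m A, u (ψ m A) * T m A * u (ψ m A) =
          ∑ k, (f k (t m A) • u (ψ m A * ψ m A)) * b k := by
        intro m A
        simp only [T, mul_sum, sum_mul, hu_mul]
        refine sum_congr rfl fun k _ => ?_
        rw [mul_smul_comm, smul_mul_assoc, mul_assoc, hb, smul_mul_assoc, mul_assoc]
      have h2 : ∑ m, ∑ A, u (ψ m A) * T m A * u (ψ m A) =
          ∑ k, (∑ m, ∑ A, f k (t m A) • u (ψ m A * ψ m A)) * b k := by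
        simp only [h1, sum_mul]
        rw [sum_comm (s := (univ : Finset (Fin n)))]
        exact sum_congr rfl fun m _ => sum_comm
      rw [h2, ← sum_add_distrib, smul_sum]
      refine sum_congr rfl fun k _ => ?_
      simp only [map_sub, map_sum, map_smul, sub_mul, add_sub_cancel, smul_mul_assoc]
      rfl
    refine le_of_mul_le_mul_left ?_ hM'
    calc (M : ℝ) * ‖∑ k, u (f k) ∘L b k‖ = ‖(M : ℂ) • ∑ k, u (f k) ∘L b k‖ := by
          simp [norm_smul]
      _ ≤ ∑ m : Fin M, ‖u‖ ^ 2 * C + ∑ k, ‖u‖ * (M * ε) * ‖b k‖ := by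
          rw [hdecomp]
          refine (norm_add_le _ _).trans (add_le_add ?_ ?_)
          · exact norm_sum_le_of_le _ fun m _ =>
              norm_sum_conj_le u hC (ψ m) (T m) (fun A => ⟨t m A, rfl⟩) (hψ m)
          · refine norm_sum_le_of_le _ fun k _ => (norm_mul_le _ _).trans ?_
            gcongr
            exact u.le_opNorm_of_le (happrox k)
      _ = M * (‖u‖ ^ 2 * C + ε * ∑ k, ‖u‖ * ‖b k‖) := by
          rw [mul_add, mul_sum, mul_sum]
          congr 1
          · simp
          · exact sum_congr rfl fun k _ => by ring
  set B := ∑ k, ‖u‖ * ‖b k‖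
  have hB : 0 ≤ B := sum_nonneg fun k _ => by positivity
  refine le_of_forall_pos_le_add fun ε hε => ?_
  refine (hmain (ε / (B + 1)) (by positivity)).trans ?_
  gcongr
  rw [div_mul_eq_mul_div, div_le_iff₀ (by positivity)]
  nlinarith
end

section
/- Let X be a Banach space with property (α). Then sup_n R(σ_{n,X}) < ∞, where σ_{n,X} : M_n → B(Rad_n(X)) sends a scalar matrix a = [a_{ij}] to the operator [a_{ij} I_X] acting on Rad_n(X). Conversely, if sup_n R(σ_{n,X}) < ∞ then X has property (α). -/
open Finset

/-- The norm of `Σ_{k,i} ε_k ⊗ ε_i ⊗ x_{k i}` in `Rad(Rad(X))`, modelled on the uniform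
probability space of pairs of sign sequences. -/
noncomputable def radNorm2 {X : Type*} [NormedAddCommGroup X] [NormedSpace ℂ X]
    {m n : ℕ} (x : Fin m → Fin n → X) : ℝ :=
  Real.sqrt ((∑ s : Fin m → Bool, ∑ t : Fin n → Bool,
    ‖∑ k, ∑ i, (((if s k then (1 : ℂ) else -1)) * ((if t i then (1 : ℂ) else -1))) • x k i‖ ^ 2)
      / 2 ^ (m + n))

/-- `X` has property (α): `‖Σ ε_i ⊗ ε_j ⊗ t_{ij} x_{ij}‖ ≤ C sup|t_{ij}| ‖Σ ε_i ⊗ ε_j ⊗ x_{ij}‖`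
(stated in the normalized form `|t_{ij}| ≤ 1`). -/
def PropertyAlpha (X : Type*) [NormedAddCommGroup X] [NormedSpace ℂ X] : Prop :=
  ∃ C : ℝ, ∀ (n : ℕ) (t : Fin n → Fin n → ℂ) (x : Fin n → Fin n → X),
    (∀ i j, ‖t i j‖ ≤ 1) →
    radNorm2 (fun i j => t i j • x i j) ≤ C * radNorm2 x

/-- `σ_{n,X} : M_n → B(Rad_n(X))`, `a ↦ [a_{ij} I_X]`, maps the unit ball of `M_n`
(for the `ℓ²` operator norm) into an `R`-bounded set with constant `C`. -/
def SigmaRBoundedWith (X : Type*) [NormedAddCommGroup X] [NormedSpace ℂ X]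
    (C : ℝ) (n : ℕ) : Prop :=
  ∀ (m : ℕ) (a : Fin m → Matrix (Fin n) (Fin n) ℂ),
    (∀ k, ∀ v : Fin n → ℂ, (∑ i, ‖∑ j, a k i j * v j‖ ^ 2) ≤ ∑ j, ‖v j‖ ^ 2) →
    ∀ z : Fin m → Fin n → X,
      radNorm2 (fun k i => ∑ j, a k i j • z k j) ≤ C * radNorm2 z

namespace RadAlpha

open MeasureTheory ProbabilityTheory Filter Topology
open scoped BigOperators

/-- The sign `±1` encoded by a Boolean. -/
def sgn (b : Bool) : ℝ := if b then 1 else -1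

@[simp] lemma sgn_true : sgn true = 1 := rfl

@[simp] lemma sgn_false : sgn false = -1 := rfl

lemma sgn_beq (a b : Bool) : sgn (a == b) = sgn a * sgn b := by
  cases a <;> cases b <;> simp [sgn]

@[simp] lemma sgn_mul_self (a : Bool) : sgn a * sgn a = 1 := by
  cases a <;> simp [sgn]

lemma abs_sgn (a : Bool) : |sgn a| = 1 := by
  cases a <;> simp [sgn]

/-- Pointwise multiplication by a fixed sign sequence, as a permutation of sign sequences. -/
def flip {ι : Type*} (u : ι → Bool) : (ι → Bool) ≃ (ι → Bool) where
  toFun s i := u i == s i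
  invFun s i := u i == s i
  left_inv s := by ext i; cases h : u i <;> cases h' : s i <;> simp [h, h']
  right_inv s := by ext i; cases h : u i <;> cases h' : s i <;> simp [h, h']

lemma flip_apply {ι : Type*} (u s : ι → Bool) (i : ι) : flip u s i = (u i == s i) := rfl

lemma expect_flip {ι : Type*} [Fintype ι] [DecidableEq ι] (u : ι → Bool) (F : (ι → Bool) → ℝ) :
    𝔼 s, F (flip u s) = 𝔼 s, F s :=
  Fintype.expect_equiv (flip u) _ _ fun _ => rfl

lemma expect_comp_embedding {ι κ : Type*} [Fintype ι] [Fintype κ] [DecidableEq ι] [DecidableEq κ]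
    (e : ι ↪ κ) (F : (ι → Bool) → ℝ) :
    𝔼 s : κ → Bool, F (fun i => s (e i)) = 𝔼 s : ι → Bool, F s := by
  classical
  let E : (κ → Bool) ≃ (ι → Bool) × ({k // ¬ k ∈ Set.range e} → Bool) :=
    (Equiv.piEquivPiSubtypeProd (fun k => k ∈ Set.range e) fun _ => Bool).trans
      (Equiv.prodCongr (Equiv.arrowCongr (Equiv.ofInjective e e.injective).symm (Equiv.refl _))
        (Equiv.refl _))
  rw [Fintype.expect_equiv E (fun s => F fun i => s (e i)) (fun p => F p.1) (fun s => rfl),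
    ← Finset.univ_product_univ, Finset.expect_product]
  simp

lemma expect_sgn_mul_sgn {ι : Type*} [Fintype ι] [DecidableEq ι] {i j : ι} (h : i ≠ j) :
    𝔼 s : ι → Bool, sgn (s i) * sgn (s j) = 0 := by
  have h1 := expect_flip (Function.update (fun _ => true) i false)
    (fun s : ι → Bool => sgn (s i) * sgn (s j))
  simp only [flip_apply, sgn_beq, Function.update_self, Function.update_of_ne h.symm, sgn_true,
    sgn_false, one_mul, neg_mul, Finset.expect_neg_distrib] at h1
  linarith

lemma expect_sq_sum_sgn {ι : Type*} [Fintype ι] [DecidableEq ι] :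
    𝔼 s : ι → Bool, (∑ i, sgn (s i)) ^ 2 = Fintype.card ι := by
  have h (s : ι → Bool) :
      (∑ i, sgn (s i)) ^ 2 = ∑ i, ∑ j, sgn (s i) * sgn (s j) := by
    rw [sq, Finset.sum_mul_sum]
  simp_rw [h, Finset.expect_sum_comm]
  have h2 (i j : ι) : 𝔼 s : ι → Bool, sgn (s i) * sgn (s j) = if i = j then 1 else 0 := by
    split_ifs with hij
    · subst hij; simp
    · exact expect_sgn_mul_sgn hij
  simp [h2]

section Rad

variable {X : Type*} [NormedAddCommGroup X] [NormedSpace ℝ X]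
  {ι κ : Type*} [Fintype ι] [Fintype κ] [DecidableEq ι] [DecidableEq κ]

/-- The squared norm of `∑ ε_i ⊗ x_i` in `Rad(X)`. -/
noncomputable def radSq (x : ι → X) : ℝ := 𝔼 s : ι → Bool, ‖∑ i, sgn (s i) • x i‖ ^ 2

/-- The squared norm of `∑ ε_k ⊗ ε_i ⊗ x_{k i}` in `Rad(Rad(X))`. -/
noncomputable def radSq2 (x : κ → ι → X) : ℝ :=
  𝔼 s : κ → Bool, 𝔼 t : ι → Bool, ‖∑ k, ∑ i, (sgn (s k) * sgn (t i)) • x k i‖ ^ 2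

lemma radSq_add_le (x y : ι → X) : radSq (x + y) ≤ 2 * (radSq x + radSq y) := by
  unfold radSq
  rw [← Finset.expect_add_distrib, Finset.mul_expect]
  refine Finset.expect_le_expect fun s _ => ?_
  simp only [Pi.add_apply, smul_add, Finset.sum_add_distrib]
  refine (pow_le_pow_left₀ (norm_nonneg _) (norm_add_le _ _) 2).trans ?_
  exact add_sq_le

/-- Averaging `Rad(Rad(X))` norms over all changes of signs of the coefficients yields the norm
for a doubly indexed Rademacher family. -/
lemma expect_radSq2_sgn (x : κ → ι → X) :
    𝔼 η : κ × ι → Bool, radSq2 (fun k i => sgn (η (k, i)) • x k i) =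
      radSq (fun p : κ × ι => x p.1 p.2) := by
  unfold radSq2
  rw [Finset.expect_comm]
  have h (s : κ → Bool) (t : ι → Bool) :
      𝔼 η : κ × ι → Bool, ‖∑ k, ∑ i, (sgn (s k) * sgn (t i)) • sgn (η (k, i)) • x k i‖ ^ 2 =
      radSq (fun p : κ × ι => x p.1 p.2) := by
    refine Eq.trans ?_ (expect_flip (fun p : κ × ι => s p.1 == t p.2) _)
    refine Finset.expect_congr rfl fun η _ => ?_
    simp only [flip_apply, sgn_beq, Fintype.sum_prod_type, smul_smul]
  have h' (s : κ → Bool) : 𝔼 η : κ × ι → Bool, 𝔼 t : ι → Bool,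
      ‖∑ k, ∑ i, (sgn (s k) * sgn (t i)) • sgn (η (k, i)) • x k i‖ ^ 2 =
      radSq (fun p : κ × ι => x p.1 p.2) := by
    rw [Finset.expect_comm]; simp only [h, Fintype.expect_const]
  simp only [h', Fintype.expect_const]

lemma radSq2_smul_const (c : ℝ) (x : κ → X) :
    radSq2 (fun k (_ : ι) => c • x k) = c ^ 2 * Fintype.card ι * radSq x := by
  unfold radSq2 radSq
  rw [Finset.mul_expect]
  refine Finset.expect_congr rfl fun s _ => ?_
  have h (t : ι → Bool) : ‖∑ k, ∑ i, (sgn (s k) * sgn (t i)) • c • x k‖ ^ 2 =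
      c ^ 2 * ‖∑ k, sgn (s k) • x k‖ ^ 2 * (∑ i, sgn (t i)) ^ 2 := by
    have : ∑ k, ∑ i, (sgn (s k) * sgn (t i)) • c • x k =
        (c * ∑ i, sgn (t i)) • ∑ k, sgn (s k) • x k := by
      rw [Finset.smul_sum]
      refine Finset.sum_congr rfl fun k _ => ?_
      rw [← Finset.sum_smul, ← Finset.mul_sum, smul_smul, smul_smul]
      congr 1; ring
    rw [this, norm_smul, mul_pow, Real.norm_eq_abs, sq_abs]; ring
  simp_rw [h]
  rw [← Finset.mul_expect, expect_sq_sum_sgn]; ring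

/-- Extending a family by zero does not change its `Rad(Rad(X))` norm. -/
lemma radSq2_extend {ι' κ' : Type*} [Fintype ι'] [Fintype κ'] [DecidableEq ι'] [DecidableEq κ']
    (e : κ ↪ κ') (f : ι ↪ ι') (x : κ → ι → X) :
    radSq2 (fun a b => ∑ k, ∑ i, if e k = a ∧ f i = b then x k i else 0) = radSq2 x := by
  have h (s : κ' → Bool) (t : ι' → Bool) :
      ∑ a, ∑ b, (sgn (s a) * sgn (t b)) • (∑ k, ∑ i, if e k = a ∧ f i = b then x k i else 0) =
      ∑ k, ∑ i, (sgn (s (e k)) * sgn (t (f i))) • x k i := by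
    simp_rw [Finset.smul_sum, smul_ite, smul_zero]
    calc _ = ∑ a, ∑ k, ∑ i, ∑ b,
          (if e k = a ∧ f i = b then (sgn (s a) * sgn (t b)) • x k i else 0) := by
          refine Finset.sum_congr rfl fun a _ => ?_
          rw [Finset.sum_comm]
          exact Finset.sum_congr rfl fun k _ => Finset.sum_comm
      _ = ∑ k, ∑ i, ∑ a, ∑ b,
          (if e k = a ∧ f i = b then (sgn (s a) * sgn (t b)) • x k i else 0) := by
          rw [Finset.sum_comm]
          exact Finset.sum_congr rfl fun k _ => Finset.sum_comm
      _ = _ := by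
          simp [ite_and, Finset.sum_ite_eq]
  unfold radSq2
  simp_rw [h]
  rw [← expect_comp_embedding e]
  refine Finset.expect_congr rfl fun s _ => ?_
  rw [← expect_comp_embedding f]

end Rad

section Alpha

variable {X : Type*} [NormedAddCommGroup X] [NormedSpace ℂ X]

lemma radNorm2_nonneg {m n : ℕ} (x : Fin m → Fin n → X) : 0 ≤ radNorm2 x := Real.sqrt_nonneg _

lemma radNorm2_sq {m n : ℕ} (x : Fin m → Fin n → X) : radNorm2 x ^ 2 = radSq2 x := by
  rw [radNorm2, Real.sq_sqrt (by positivity), radSq2, Fintype.expect_eq_sum_div_card]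
  simp_rw [Fintype.expect_eq_sum_div_card]
  rw [← Finset.sum_div, div_div, pow_add, mul_comm (2 ^ m : ℝ)]
  have h (b : Bool) : (if b then (1 : ℂ) else -1) = (sgn b : ℂ) := by
    cases b <;> simp [sgn]
  simp_rw [h, ← Complex.ofReal_mul, Complex.coe_smul]
  simp

/-- Squared form of property (α), for families indexed by arbitrary finite types. -/
def SqAlphaWith (X : Type*) [NormedAddCommGroup X] [NormedSpace ℂ X] (B : ℝ) : Prop :=
  ∀ (κ ι : Type) [Fintype κ] [Fintype ι] [DecidableEq κ] [DecidableEq ι] (t : κ → ι → ℂ)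
    (x : κ → ι → X), (∀ k i, ‖t k i‖ ≤ 1) →
      radSq2 (fun k i => t k i • x k i) ≤ B * radSq2 x

lemma sqAlphaWith_of_radNorm2_le {C : ℝ}
    (h : ∀ (n : ℕ) (t : Fin n → Fin n → ℂ) (x : Fin n → Fin n → X), (∀ i j, ‖t i j‖ ≤ 1) →
      radNorm2 (fun i j => t i j • x i j) ≤ C * radNorm2 x) : SqAlphaWith X (C ^ 2) := by
  intro κ ι _ _ _ _ t x ht
  let e : κ ↪ Fin (Fintype.card κ + Fintype.card ι) :=
    (Fintype.equivFin κ).toEmbedding.trans (Fin.castAddEmb _)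
  let f : ι ↪ Fin (Fintype.card κ + Fintype.card ι) :=
    (Fintype.equivFin ι).toEmbedding.trans (Fin.natAddEmb _)
  let t' : Fin (Fintype.card κ + Fintype.card ι) → Fin (Fintype.card κ + Fintype.card ι) → ℂ :=
    fun a b => if hab : (∃ k, e k = a) ∧ ∃ i, f i = b then t hab.1.choose hab.2.choose else 0
  have ht' : ∀ a b, ‖t' a b‖ ≤ 1 := by
    intro a b
    by_cases hab : (∃ k, e k = a) ∧ ∃ i, f i = b
    · simp only [t', dif_pos hab]; exact ht _ _
    · simp [t', dif_neg hab]
  have hte : ∀ k i, t' (e k) (f i) = t k i := by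
    intro k i
    have hab : (∃ k', e k' = e k) ∧ ∃ i', f i' = f i := ⟨⟨k, rfl⟩, ⟨i, rfl⟩⟩
    simp only [t', dif_pos hab]
    rw [e.injective hab.1.choose_spec, f.injective hab.2.choose_spec]
  have key := pow_le_pow_left₀ (radNorm2_nonneg _)
    (h _ t' (fun a b => ∑ k, ∑ i, if e k = a ∧ f i = b then x k i else 0) ht') 2
  rw [mul_pow, radNorm2_sq, radNorm2_sq, radSq2_extend] at key
  refine le_of_eq_of_le ?_ key
  rw [← radSq2_extend e f]
  congr 1
  ext a b
  simp_rw [Finset.smul_sum, smul_ite, smul_zero]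
  refine Finset.sum_congr rfl fun k _ => Finset.sum_congr rfl fun i _ => ?_
  split_ifs with hab
  · rw [← hab.1, ← hab.2, hte]
  · rfl

section Compare

variable {κ ι : Type} [Fintype κ] [Fintype ι] [DecidableEq κ] [DecidableEq ι] {B : ℝ}

lemma SqAlphaWith.sgn (h : SqAlphaWith X B) (η : κ × ι → Bool) (x : κ → ι → X) :
    radSq2 (fun k i => sgn (η (k, i)) • x k i) ≤ B * radSq2 x := by
  have := h κ ι (fun k i => (RadAlpha.sgn (η (k, i)) : ℂ)) x fun k i => by simp [abs_sgn]
  simpa only [Complex.coe_smul] using this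

lemma SqAlphaWith.radSq_le (h : SqAlphaWith X B) (x : κ → ι → X) :
    radSq (fun p : κ × ι => x p.1 p.2) ≤ B * radSq2 x := by
  rw [← expect_radSq2_sgn]
  refine (Finset.expect_le_expect fun η _ => h.sgn η x).trans_eq ?_
  simp

lemma SqAlphaWith.radSq2_le (h : SqAlphaWith X B) (x : κ → ι → X) :
    radSq2 x ≤ B * radSq (fun p : κ × ι => x p.1 p.2) := by
  rw [← expect_radSq2_sgn, Finset.mul_expect]
  have : radSq2 x = 𝔼 _η : κ × ι → Bool, radSq2 x := by simp
  rw [this]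
  refine Finset.expect_le_expect fun η _ => ?_
  simpa only [smul_smul, sgn_mul_self, one_smul] using
    h.sgn η (fun k i => RadAlpha.sgn (η (k, i)) • x k i)

/-- Normalised sums of independent signs as coefficients are controlled by a single sign. -/
lemma SqAlphaWith.expect_sum_le (h : SqAlphaWith X B) (x : κ → X) {N : ℕ} (hN : 0 < N) :
    𝔼 t : κ × Fin N → Bool, ‖∑ k, ((√N)⁻¹ * ∑ j, RadAlpha.sgn (t (k, j))) • x k‖ ^ 2 ≤
      B * radSq x := by
  have h1 := h.radSq_le (fun k (_ : Fin N) => (√N : ℝ)⁻¹ • x k)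
  have h2 : ((√N : ℝ)⁻¹) ^ 2 * N = 1 := by
    rw [inv_pow, Real.sq_sqrt (Nat.cast_nonneg _)]
    have : (N : ℝ) ≠ 0 := by positivity
    field_simp
  rw [radSq2_smul_const, Fintype.card_fin, h2, one_mul] at h1
  refine le_of_eq_of_le ?_ h1
  refine Finset.expect_congr rfl fun t _ => ?_
  simp only [Fintype.sum_prod_type, smul_smul, ← Finset.sum_smul, ← Finset.sum_mul]
  simp only [mul_comm]

end Compare

end Alpha

section Gaussian

lemma integral_uniformOfFintype {Ω : Type*} [Fintype Ω] [Nonempty Ω] [MeasurableSpace Ω]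
    [MeasurableSingletonClass Ω] {F : Type*} [NormedAddCommGroup F] [NormedSpace ℝ F]
    [CompleteSpace F] (f : Ω → F) :
    ∫ ω, f ω ∂(PMF.uniformOfFintype Ω).toMeasure = (Fintype.card Ω : ℝ)⁻¹ • ∑ ω, f ω := by
  rw [PMF.integral_eq_sum, Finset.smul_sum]
  simp

lemma norm_sq_integral_le {Ω : Type*} [MeasurableSpace Ω] {P : Measure Ω} [IsProbabilityMeasure P]
    {X : Type*} [NormedAddCommGroup X] [NormedSpace ℝ X] [CompleteSpace X] {f : Ω → X}
    (hf : MemLp f 2 P) : ‖∫ ω, f ω ∂P‖ ^ 2 ≤ ∫ ω, ‖f ω‖ ^ 2 ∂P := by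
  have hc : ConvexOn ℝ Set.univ fun x : X => ‖x‖ ^ 2 :=
    convexOn_univ_norm.pow (fun _ _ => norm_nonneg _) 2
  exact hc.map_integral_le (by fun_prop) isClosed_univ (by simp) (hf.integrable (by norm_num))
    (hf.integrable_norm_pow (by norm_num))

variable {ι : Type*} [Fintype ι] {X : Type*} [NormedAddCommGroup X] [NormedSpace ℝ X]

lemma integrable_norm_sq_clm (μ : Measure (EuclideanSpace ℝ ι)) [IsGaussian μ]
    (L : EuclideanSpace ℝ ι →L[ℝ] X) : Integrable (fun v => ‖L v‖ ^ 2) μ :=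
  (L.comp_memLp' (IsGaussian.memLp_two_id (μ := μ))).integrable_norm_pow (by norm_num)

lemma memLp_pi_gaussianReal_sum {f : ℝ → ℝ} (hf : MemLp f 2 (gaussianReal 0 1)) (y : ι → X) :
    MemLp (fun v : ι → ℝ => ∑ i, f (v i) • y i) 2 (Measure.pi fun _ => gaussianReal 0 1) := by
  refine memLp_finsetSum _ fun i _ => ?_
  have h1 : MemLp (fun v : ι → ℝ => f (v i)) 2 (Measure.pi fun _ : ι => gaussianReal 0 1) :=
    hf.comp_measurePreserving (measurePreserving_eval (fun _ : ι => gaussianReal 0 1) i)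
  exact (ContinuousLinearMap.toSpanSingleton ℝ (y i)).comp_memLp' h1

/-- Convolving with a centred Gaussian measure increases second moments. -/
lemma integral_norm_sq_le_conv [CompleteSpace X] {μ ν : Measure (EuclideanSpace ℝ ι)}
    [IsGaussian μ] [IsGaussian ν] (hν : ∫ v, v ∂ν = 0)
    (L : EuclideanSpace ℝ ι →L[ℝ] X) :
    ∫ v, ‖L v‖ ^ 2 ∂μ ≤ ∫ v, ‖L v‖ ^ 2 ∂(μ ∗ ν) := by
  have hi : Integrable (fun v => ‖L v‖ ^ 2) (μ ∗ ν) := integrable_norm_sq_clm _ L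
  rw [integral_conv hi]
  refine integral_mono (integrable_norm_sq_clm _ L) ?_ fun v => ?_
  · simpa using ((integrable_conv_iff hi.aestronglyMeasurable).1 hi).2
  · have hid : Integrable (fun w : EuclideanSpace ℝ ι => w) ν := IsGaussian.integrable_id
    have hL : MemLp (fun w => L w) 2 ν := L.comp_memLp' (IsGaussian.memLp_two_id (μ := ν))
    have hm : MemLp (fun w => L v + L w) 2 ν := (memLp_const (L v)).add hL
    have hint : ∫ w, (L v + L w) ∂ν = L v := by
      rw [integral_add (integrable_const _) (hL.integrable (by norm_num)),
        L.integral_comp_comm hid]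
      simp [hν]
    simp only [map_add]
    simpa only [hint] using norm_sq_integral_le hm

variable [DecidableEq ι]

/-- The vector whose coordinates are normalised sums of `N` signs. -/
noncomputable def signSum (N : ℕ) (t : ι × Fin N → Bool) : EuclideanSpace ℝ ι :=
  WithLp.toLp 2 fun i => (√N)⁻¹ * ∑ j, sgn (t (i, j))

/-- The law of a vector of normalised sums of independent signs. -/
noncomputable def signLaw (ι : Type*) [Fintype ι] [DecidableEq ι] (N : ℕ) :
    ProbabilityMeasure (EuclideanSpace ℝ ι) :=
  ⟨(PMF.uniformOfFintype (ι × Fin N → Bool)).toMeasure.map (signSum N),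
    Measure.isProbabilityMeasure_map (measurable_of_finite _).aemeasurable⟩

lemma charFun_signLaw (N : ℕ) (ξ : EuclideanSpace ℝ ι) :
    charFun (signLaw ι N : Measure (EuclideanSpace ℝ ι)) ξ =
      ∏ i, (charFun ((PMF.uniformOfFintype Bool).toMeasure.map sgn) ((√N)⁻¹ * ξ i)) ^ N := by
  have h1 (u : ℝ) : charFun ((PMF.uniformOfFintype Bool).toMeasure.map sgn) u =
      (2 : ℂ)⁻¹ * ∑ b : Bool, Complex.exp (u * sgn b * Complex.I) := by
    rw [charFun_apply_real, integral_map (measurable_of_finite _).aemeasurable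
      (by fun_prop), integral_uniformOfFintype]
    simp [mul_add]
  have h2 : charFun (signLaw ι N : Measure (EuclideanSpace ℝ ι)) ξ =
      (2 : ℂ)⁻¹ ^ (Fintype.card ι * N) * ∑ t : ι × Fin N → Bool,
        ∏ p : ι × Fin N, Complex.exp (((√N)⁻¹ * ξ p.1 : ℝ) * sgn (t p) * Complex.I) := by
    rw [charFun_apply, signLaw, ProbabilityMeasure.coe_mk,
      integral_map (measurable_of_finite _).aemeasurable (by fun_prop), integral_uniformOfFintype]
    simp only [Fintype.card_pi, Fintype.card_bool, Finset.prod_const, Finset.card_univ,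
      Fintype.card_prod, Fintype.card_fin, ← Complex.exp_sum]
    rw [Complex.real_smul]
    congr 1
    · simp
    · refine Finset.sum_congr rfl fun t _ => ?_
      congr 1
      rw [PiLp.inner_apply, Fintype.sum_prod_type, Complex.ofReal_sum, Finset.sum_mul]
      refine Finset.sum_congr rfl fun i _ => ?_
      simp only [signSum, RCLike.inner_apply, conj_trivial]
      push_cast
      rw [← Finset.sum_mul, ← Finset.mul_sum]
      ring
  rw [h2]
  simp_rw [h1, mul_pow]
  rw [Finset.prod_mul_distrib, Finset.prod_const, Finset.card_univ, ← pow_mul, mul_comm N]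
  congr 1
  have h3 := Finset.prod_univ_sum (fun _ : ι × Fin N => (Finset.univ : Finset Bool))
    (fun p b => Complex.exp (((√N)⁻¹ * ξ p.1 : ℝ) * sgn b * Complex.I))
  rw [Fintype.piFinset_univ] at h3
  rw [← h3, Fintype.prod_prod_type]
  simp

lemma tendsto_signLaw :
    Tendsto (signLaw ι) atTop (𝓝 ⟨stdGaussian (EuclideanSpace ℝ ι), inferInstance⟩) := by
  refine ProbabilityMeasure.tendsto_iff_tendsto_charFun.2 fun ξ => ?_
  simp_rw [charFun_signLaw]
  rw [ProbabilityMeasure.coe_mk, charFun_stdGaussian]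
  have h : Complex.exp (-(‖ξ‖ : ℂ) ^ 2 / 2) = ∏ i, Complex.exp (-(ξ i : ℂ) ^ 2 / 2) := by
    rw [← Complex.exp_sum, ← Complex.ofReal_pow, EuclideanSpace.real_norm_sq_eq]
    push_cast
    rw [← Finset.sum_div, Finset.sum_neg_distrib]
  rw [h]
  refine tendsto_finsetProd _ fun i _ => ?_
  refine tendsto_charFun_inv_sqrt_mul_pow (measurable_of_finite _).aemeasurable ?_ ?_ (ξ i)
  · rw [integral_uniformOfFintype]; simp
  · rw [integral_uniformOfFintype]; norm_num

lemma integral_stdGaussian_le_of_signLaw {K : ℝ} (L : EuclideanSpace ℝ ι →L[ℝ] X)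
    (hK : ∀ N : ℕ, 0 < N → ∫ v, ‖L v‖ ^ 2 ∂(signLaw ι N : Measure (EuclideanSpace ℝ ι)) ≤ K) :
    ∫ v, ‖L v‖ ^ 2 ∂(stdGaussian (EuclideanSpace ℝ ι)) ≤ K := by
  have hK0 : 0 ≤ K := (integral_nonneg fun _ => sq_nonneg _).trans (hK 1 one_pos)
  have h := lintegral_le_liminf_lintegral_of_forall_isOpen_measure_le_liminf_measure
    (μ := stdGaussian (EuclideanSpace ℝ ι))
    (μs := fun N => (signLaw ι N : Measure (EuclideanSpace ℝ ι)))
    (f := fun v => ‖L v‖ ^ 2) (by fun_prop) (fun _ => sq_nonneg _)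
    (fun G hG => ProbabilityMeasure.le_liminf_measure_open_of_tendsto tendsto_signLaw hG)
  rw [← ofReal_integral_eq_lintegral_ofReal (integrable_norm_sq_clm _ L)
    (ae_of_all _ fun _ => sq_nonneg _)] at h
  rw [← ENNReal.ofReal_le_ofReal_iff hK0]
  refine h.trans ?_
  refine liminf_le_of_frequently_le' (Eventually.frequently ?_)
  filter_upwards [eventually_gt_atTop 0] with N hN
  rw [← ofReal_integral_eq_lintegral_ofReal _ (ae_of_all _ fun _ => sq_nonneg _)]
  · exact ENNReal.ofReal_le_ofReal (hK N hN)
  · rw [signLaw, ProbabilityMeasure.coe_mk,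
      integrable_map_measure (by fun_prop) (measurable_of_finite _).aemeasurable]
    exact Integrable.of_finite

lemma integral_signLaw [CompleteSpace X] (N : ℕ) (L : EuclideanSpace ℝ ι →L[ℝ] X) :
    ∫ v, ‖L v‖ ^ 2 ∂(signLaw ι N : Measure (EuclideanSpace ℝ ι)) =
      𝔼 t : ι × Fin N → Bool, ‖L (signSum N t)‖ ^ 2 := by
  rw [signLaw, ProbabilityMeasure.coe_mk,
    integral_map (measurable_of_finite _).aemeasurable (by fun_prop), integral_uniformOfFintype,
    Fintype.expect_eq_sum_div_card, smul_eq_mul, inv_mul_eq_div]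

open scoped Matrix in
/-- A contraction decreases second moments of the standard Gaussian measure. -/
lemma integral_contraction_le [CompleteSpace X] (A : Matrix ι ι ℝ)
    (hA : ∀ v : ι → ℝ, ∑ i, (∑ j, A i j * v j) ^ 2 ≤ ∑ j, v j ^ 2)
    (L : EuclideanSpace ℝ ι →L[ℝ] X) :
    ∫ v, ‖L (Matrix.toEuclideanCLM (𝕜 := ℝ) Aᵀ v)‖ ^ 2 ∂(stdGaussian (EuclideanSpace ℝ ι)) ≤
      ∫ v, ‖L v‖ ^ 2 ∂(stdGaussian (EuclideanSpace ℝ ι)) := by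
  set T := Matrix.toEuclideanCLM (𝕜 := ℝ) Aᵀ with hT
  have hquad (v : ι → ℝ) : v ⬝ᵥ (1 - Aᵀ * A) *ᵥ v =
      ∑ j, v j ^ 2 - ∑ i, (∑ j, A i j * v j) ^ 2 := by
    rw [Matrix.sub_mulVec, dotProduct_sub, Matrix.one_mulVec, ← Matrix.mulVec_mulVec,
      Matrix.dotProduct_mulVec, Matrix.vecMul_transpose]
    simp [dotProduct, Matrix.mulVec, sq]
  have hS : (1 - Aᵀ * A).PosSemidef := by
    refine Matrix.PosSemidef.of_dotProduct_mulVec_nonneg ?_ fun v => ?_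
    · simp [Matrix.IsHermitian]
    · rw [star_trivial, hquad]
      linarith [hA v]
  have hadj (v ξ : EuclideanSpace ℝ ι) :
      inner ℝ (T v) ξ = inner ℝ v (Matrix.toEuclideanCLM (𝕜 := ℝ) A ξ) := by
    have : T = star (Matrix.toEuclideanCLM (𝕜 := ℝ) A) := by
      rw [hT, ← map_star]
      simp [Matrix.star_eq_conjTranspose]
    rw [this, ContinuousLinearMap.star_eq_adjoint, ContinuousLinearMap.adjoint_inner_left]
  have hconv : (stdGaussian (EuclideanSpace ℝ ι)).map T ∗
      multivariateGaussian 0 (1 - Aᵀ * A) = stdGaussian (EuclideanSpace ℝ ι) := by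
    refine Measure.ext_of_charFun ?_
    ext ξ
    have h1 : charFun ((stdGaussian (EuclideanSpace ℝ ι)).map T) ξ =
        charFun (stdGaussian (EuclideanSpace ℝ ι)) (Matrix.toEuclideanCLM (𝕜 := ℝ) A ξ) := by
      rw [charFun_apply, charFun_apply, integral_map (by fun_prop) (by fun_prop)]
      simp_rw [hadj]
    have h2 : ‖Matrix.toEuclideanCLM (𝕜 := ℝ) A ξ‖ ^ 2 = ∑ i, (∑ j, A i j * ξ j) ^ 2 := by
      rw [EuclideanSpace.real_norm_sq_eq]
      rfl
    rw [charFun_conv, h1, charFun_stdGaussian, charFun_stdGaussian,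
      charFun_multivariateGaussian hS, hquad, ← Complex.exp_add, ← Complex.ofReal_pow,
      ← Complex.ofReal_pow, h2, EuclideanSpace.real_norm_sq_eq]
    congr 1
    simp
    ring
  have h := integral_norm_sq_le_conv (μ := (stdGaussian (EuclideanSpace ℝ ι)).map T)
    (ν := multivariateGaussian 0 (1 - Aᵀ * A)) integral_id_multivariateGaussian L
  rwa [hconv, integral_map (by fun_prop) (by fun_prop)] at h

/-- The first absolute moment of the standard Gaussian distribution. -/
noncomputable def gaussAbs : ℝ := ∫ x, |x| ∂(gaussianReal 0 1)

lemma gaussAbs_pos : 0 < gaussAbs := by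
  have hi : Integrable (fun x : ℝ => |x|) (gaussianReal 0 1) :=
    (IsGaussian.integrable_id (μ := gaussianReal 0 1)).abs
  rw [gaussAbs, integral_pos_iff_support_of_nonneg (fun _ => abs_nonneg _) hi]
  have : Function.support (fun x : ℝ => |x|) = {0}ᶜ := by ext; simp
  rw [this, prob_compl_eq_one_sub (measurableSet_singleton 0)]
  have := nullSingletonClass_gaussianReal (μ := 0) (v := 1) one_ne_zero
  simp

lemma measurePreserving_sgn_gaussianReal (b : Bool) :
    MeasurePreserving (fun x : ℝ => sgn b * x) (gaussianReal 0 1) (gaussianReal 0 1) := by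
  refine ⟨by fun_prop, ?_⟩
  rw [gaussianReal_map_const_mul]
  cases b <;> simp [sgn]

/-- Rademacher sums are dominated by Gaussian sums. -/
lemma gaussAbs_sq_mul_radSq_le [CompleteSpace X] (y : ι → X) :
    gaussAbs ^ 2 * radSq y ≤
      ∫ v, ‖∑ i, v i • y i‖ ^ 2 ∂(stdGaussian (EuclideanSpace ℝ ι)) := by
  rw [← map_pi_eq_stdGaussian, integral_map (by fun_prop) (by fun_prop)]
  set P : Measure (ι → ℝ) := Measure.pi fun _ => gaussianReal 0 1 with hP
  have hid : MemLp (fun x : ℝ => x) 2 (gaussianReal 0 1) := IsGaussian.memLp_two_id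
  have habs : MemLp (fun x : ℝ => |x|) 2 (gaussianReal 0 1) := hid.abs
  have hflip (s : ι → Bool) : ∫ v, ‖∑ i, (sgn (s i) * v i) • y i‖ ^ 2 ∂P =
      ∫ v, ‖∑ i, v i • y i‖ ^ 2 ∂P := by
    have hmp : MeasurePreserving (fun (v : ι → ℝ) i => sgn (s i) * v i) P P :=
      measurePreserving_pi _ _ fun i => measurePreserving_sgn_gaussianReal (s i)
    have := integral_map (μ := P) hmp.measurable.aemeasurable
      (f := fun v : ι → ℝ => ‖∑ i, v i • y i‖ ^ 2)
      (by fun_prop : Continuous fun v : ι → ℝ => ‖∑ i, v i • y i‖ ^ 2).aestronglyMeasurable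
    rw [← this, hmp.map_eq]
  have hjensen (s : ι → Bool) : gaussAbs ^ 2 * ‖∑ i, sgn (s i) • y i‖ ^ 2 ≤
      ∫ v, ‖∑ i, |v i| • sgn (s i) • y i‖ ^ 2 ∂P := by
    refine le_of_eq_of_le ?_
      (norm_sq_integral_le (memLp_pi_gaussianReal_sum habs fun i => sgn (s i) • y i))
    rw [integral_finsetSum]
    · have (i : ι) : ∫ v, |v i| • sgn (s i) • y i ∂P = gaussAbs • sgn (s i) • y i := by
        rw [integral_smul_const, gaussAbs, hP,
          integral_comp_eval (μ := fun _ => gaussianReal 0 1) (i := i) (f := fun x : ℝ => |x|)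
            (by fun_prop)]
      simp_rw [this]
      rw [← Finset.smul_sum, norm_smul, mul_pow, Real.norm_eq_abs, sq_abs]
    · intro i _
      refine Integrable.smul_const ?_ _
      exact (measurePreserving_eval (fun _ : ι => gaussianReal 0 1) i).integrable_comp_of_integrable
        (habs.integrable (by norm_num))
  have hpoint (v : ι → ℝ) : 𝔼 s : ι → Bool, ‖∑ i, |v i| • sgn (s i) • y i‖ ^ 2 =
      𝔼 s : ι → Bool, ‖∑ i, (sgn (s i) * v i) • y i‖ ^ 2 := by
    rw [← expect_flip (fun i => decide (0 ≤ v i))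
      (fun s : ι → Bool => ‖∑ i, |v i| • sgn (s i) • y i‖ ^ 2)]
    refine Finset.expect_congr rfl fun s _ => ?_
    congr 2
    refine Finset.sum_congr rfl fun i _ => ?_
    rw [flip_apply, sgn_beq, smul_smul]
    congr 1
    by_cases h : 0 ≤ v i
    · simp [h, abs_of_nonneg h, mul_comm]
    · simp [h, abs_of_neg (not_le.1 h), mul_comm]
  have hint1 (s : ι → Bool) : Integrable (fun v => ‖∑ i, |v i| • sgn (s i) • y i‖ ^ 2) P :=
    (memLp_pi_gaussianReal_sum habs fun i => sgn (s i) • y i).integrable_norm_pow (by norm_num)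
  have hint2 (s : ι → Bool) : Integrable (fun v => ‖∑ i, (sgn (s i) * v i) • y i‖ ^ 2) P := by
    have := (memLp_pi_gaussianReal_sum hid fun i => sgn (s i) • y i).integrable_norm_pow
      (p := 2) (by norm_num)
    refine this.congr (ae_of_all _ fun v => ?_)
    simp [smul_smul, mul_comm]
  have hswap {F : (ι → Bool) → (ι → ℝ) → ℝ} (hF : ∀ s, Integrable (F s) P) :
      𝔼 s, ∫ v, F s v ∂P = ∫ v, 𝔼 s, F s v ∂P := by
    simp_rw [Fintype.expect_eq_sum_div_card]
    rw [integral_div, integral_finsetSum _ fun s _ => hF s]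
  calc gaussAbs ^ 2 * radSq y
      ≤ 𝔼 s : ι → Bool, ∫ v, ‖∑ i, |v i| • sgn (s i) • y i‖ ^ 2 ∂P := by
        rw [radSq, Finset.mul_expect]
        exact Finset.expect_le_expect fun s _ => hjensen s
    _ = 𝔼 s : ι → Bool, ∫ v, ‖∑ i, (sgn (s i) * v i) • y i‖ ^ 2 ∂P := by
        rw [hswap hint1, hswap hint2]
        simp_rw [hpoint]
    _ = ∫ v, ‖∑ i, v i • y i‖ ^ 2 ∂P := by
        simp only [hflip, Fintype.expect_const]

/-- If Gaussian-like sums of signs with coefficients `x` are bounded, then so are all Rademacher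
sums of the image of `x` under a real contraction. -/
lemma radSq_contraction_le [CompleteSpace X] (A : Matrix ι ι ℝ)
    (hA : ∀ v : ι → ℝ, ∑ i, (∑ j, A i j * v j) ^ 2 ≤ ∑ j, v j ^ 2) (x : ι → X) {K : ℝ}
    (hK : ∀ N : ℕ, 0 < N →
      𝔼 t : ι × Fin N → Bool, ‖∑ i, ((√N)⁻¹ * ∑ j, sgn (t (i, j))) • x i‖ ^ 2 ≤ K) :
    gaussAbs ^ 2 * radSq (fun i => ∑ j, A i j • x j) ≤ K := by
  let L : EuclideanSpace ℝ ι →L[ℝ] X :=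
    ∑ i, (ContinuousLinearMap.toSpanSingleton ℝ (x i)).comp (EuclideanSpace.proj i)
  have hL (v : EuclideanSpace ℝ ι) : L v = ∑ i, v i • x i := by
    simp [L]
  have hLT (v : EuclideanSpace ℝ ι) : L (Matrix.toEuclideanCLM (𝕜 := ℝ) A.transpose v) =
      ∑ i, v i • ∑ j, A i j • x j := by
    rw [hL]
    simp_rw [Finset.smul_sum, smul_smul]
    rw [Finset.sum_comm]
    refine Finset.sum_congr rfl fun j _ => ?_
    rw [← Finset.sum_smul]
    congr 1
    simp [Matrix.mulVec, dotProduct, mul_comm]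
  refine (gaussAbs_sq_mul_radSq_le _).trans ?_
  simp_rw [← hLT]
  refine (integral_contraction_le A hA L).trans (integral_stdGaussian_le_of_signLaw L ?_)
  intro N hN
  rw [integral_signLaw]
  simpa only [hL, signSum] using hK N hN

end Gaussian

section Contraction

variable {X : Type*} [NormedAddCommGroup X] [NormedSpace ℂ X]

lemma radSq_complex_smul {ι : Type*} [Fintype ι] [DecidableEq ι] {c : ℂ} (hc : ‖c‖ = 1)
    (x : ι → X) : radSq (fun i => c • x i) = radSq x := by
  unfold radSq
  refine Finset.expect_congr rfl fun s _ => ?_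
  simp_rw [smul_comm _ c, ← Finset.smul_sum, norm_smul, hc, one_mul]

/-- A block diagonal matrix of real parts or imaginary parts of contractions is a contraction. -/
lemma blockDiagonal_contraction {κ ι : Type*} [Fintype κ] [DecidableEq κ] [Fintype ι]
    {a : κ → Matrix ι ι ℂ}
    (ha : ∀ k, ∀ v : ι → ℂ, ∑ i, ‖∑ j, a k i j * v j‖ ^ 2 ≤ ∑ j, ‖v j‖ ^ 2)
    (f : ℂ →ₗ[ℝ] ℝ) (hf : ∀ c, |f c| ≤ ‖c‖) (v : κ × ι → ℝ) :
    ∑ p : κ × ι, (∑ q : κ × ι,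
      (if p.1 = q.1 then f (a p.1 p.2 q.2) else 0) * v q) ^ 2 ≤ ∑ q, v q ^ 2 := by
  rw [Fintype.sum_prod_type, Fintype.sum_prod_type]
  refine Finset.sum_le_sum fun k _ => ?_
  have h := ha k fun j => (v (k, j) : ℂ)
  simp only [Complex.norm_real, Real.norm_eq_abs, sq_abs] at h
  refine le_trans (Finset.sum_le_sum fun i _ => ?_) h
  have h1 : ∑ q : κ × ι, (if k = q.1 then f (a k i q.2) else 0) * v q =
      f (∑ j, a k i j * v (k, j)) := by
    rw [Fintype.sum_prod_type, Finset.sum_eq_single k]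
    · simp only [if_true, map_sum]
      refine Finset.sum_congr rfl fun j _ => ?_
      rw [mul_comm (a k i j), ← Complex.real_smul, map_smul, smul_eq_mul, mul_comm]
    · intro b _ hb
      simp [hb.symm]
    · simp
  rw [h1, ← sq_abs]
  gcongr
  exact hf _

/-- Real and imaginary parts of contractive matrices act boundedly on Rademacher sums. -/
lemma SqAlphaWith.blockDiagonal_radSq_le [CompleteSpace X] {B : ℝ} (h : SqAlphaWith X B)
    {κ ι : Type} [Fintype κ] [DecidableEq κ] [Fintype ι] [DecidableEq ι]
    {a : κ → Matrix ι ι ℂ}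
    (ha : ∀ k, ∀ v : ι → ℂ, ∑ i, ‖∑ j, a k i j * v j‖ ^ 2 ≤ ∑ j, ‖v j‖ ^ 2)
    (f : ℂ →ₗ[ℝ] ℝ) (hf : ∀ c, |f c| ≤ ‖c‖) (x : κ × ι → X) :
    gaussAbs ^ 2 * radSq (fun p : κ × ι => ∑ j, f (a p.1 p.2 j) • x (p.1, j)) ≤
      B * radSq x := by
  have h1 := radSq_contraction_le
    (Matrix.of fun p q : κ × ι => if p.1 = q.1 then f (a p.1 p.2 q.2) else 0)
    (blockDiagonal_contraction ha f hf) x (fun N hN => h.expect_sum_le x hN)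
  refine le_of_eq_of_le ?_ h1
  congr 2
  ext p
  rw [Fintype.sum_prod_type, Finset.sum_eq_single p.1]
  · simp
  · intro b _ hb
    simp [hb.symm]
  · simp

/-- Contractive scalar matrices act boundedly on Rademacher sums, uniformly in their size. -/
lemma SqAlphaWith.radSq2_matrix_le [CompleteSpace X] {B : ℝ} (hB : 0 ≤ B) (h : SqAlphaWith X B)
    {κ ι : Type} [Fintype κ] [DecidableEq κ] [Fintype ι] [DecidableEq ι]
    {a : κ → Matrix ι ι ℂ}
    (ha : ∀ k, ∀ v : ι → ℂ, ∑ i, ‖∑ j, a k i j * v j‖ ^ 2 ≤ ∑ j, ‖v j‖ ^ 2)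
    (z : κ → ι → X) :
    gaussAbs ^ 2 * radSq2 (fun k i => ∑ j, a k i j • z k j) ≤ 4 * B ^ 3 * radSq2 z := by
  set x : κ × ι → X := fun p => z p.1 p.2 with hx
  set u : κ × ι → X := fun p => ∑ j, (a p.1 p.2 j).re • x (p.1, j) with hu
  set v : κ × ι → X := fun p => ∑ j, (a p.1 p.2 j).im • x (p.1, j) with hv
  have hre : gaussAbs ^ 2 * radSq u ≤ B * radSq x :=
    h.blockDiagonal_radSq_le ha Complex.reLm Complex.abs_re_le_norm x
  have him : gaussAbs ^ 2 * radSq v ≤ B * radSq x :=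
    h.blockDiagonal_radSq_le ha Complex.imLm Complex.abs_im_le_norm x
  have hw : (fun p : κ × ι => ∑ j, a p.1 p.2 j • z p.1 j) = u + fun p => Complex.I • v p := by
    ext p
    simp only [hu, hv, hx, Pi.add_apply, Finset.smul_sum, ← Finset.sum_add_distrib]
    refine Finset.sum_congr rfl fun j _ => ?_
    rw [← Complex.coe_smul, ← Complex.coe_smul, smul_smul, ← add_smul, mul_comm Complex.I,
      Complex.re_add_im]
  have hsplit := radSq_add_le u (fun p => Complex.I • v p)
  rw [radSq_complex_smul Complex.norm_I, ← hw] at hsplit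
  have hdec := h.radSq2_le fun k i => ∑ j, a k i j • z k j
  have hz : radSq x ≤ B * radSq2 z := h.radSq_le z
  calc gaussAbs ^ 2 * radSq2 (fun k i => ∑ j, a k i j • z k j)
      ≤ gaussAbs ^ 2 * (B * (2 * (radSq u + radSq v))) := by
        gcongr
        exact hdec.trans (by gcongr)
    _ = B * 2 * (gaussAbs ^ 2 * radSq u + gaussAbs ^ 2 * radSq v) := by ring
    _ ≤ B * 2 * (B * (B * radSq2 z) + B * (B * radSq2 z)) := by
        have hK : B * radSq x ≤ B * (B * radSq2 z) := mul_le_mul_of_nonneg_left hz hB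
        exact mul_le_mul_of_nonneg_left (add_le_add (hre.trans hK) (him.trans hK)) (by positivity)
    _ = 4 * B ^ 3 * radSq2 z := by ring

lemma exists_sigmaRBoundedWith_of_propertyAlpha [CompleteSpace X] (h : PropertyAlpha X) :
    ∃ C : ℝ, ∀ n : ℕ, SigmaRBoundedWith X C n := by
  obtain ⟨C, hC⟩ := h
  have hα : SqAlphaWith X (C ^ 2) := sqAlphaWith_of_radNorm2_le hC
  have hg := gaussAbs_pos
  refine ⟨2 * |C| ^ 3 / gaussAbs, fun n m a ha z => ?_⟩
  have h1 := hα.radSq2_matrix_le (sq_nonneg C) ha z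
  rw [← radNorm2_sq, ← radNorm2_sq] at h1
  rw [div_mul_eq_mul_div, le_div_iff₀ hg]
  refine le_of_sq_le_sq ?_ (mul_nonneg (by positivity) (radNorm2_nonneg _))
  calc _ = gaussAbs ^ 2 * radNorm2 (fun k i => ∑ j, a k i j • z k j) ^ 2 := by ring
    _ ≤ _ := h1
    _ = _ := by rw [← sq_abs C]; ring

lemma propertyAlpha_of_sigmaRBoundedWith {C : ℝ} (h : ∀ n : ℕ, SigmaRBoundedWith X C n) :
    PropertyAlpha X := by
  refine ⟨C, fun n t x ht => ?_⟩
  have h1 := h n n (fun k => Matrix.diagonal (t k)) (fun k v => ?_) x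
  · simpa [Matrix.diagonal_apply, ite_smul] using h1
  · refine Finset.sum_le_sum fun i _ => ?_
    have h2 : ∑ j, Matrix.diagonal (t k) i j * v j = t k i * v i := by
      simp [Matrix.diagonal_apply]
    rw [h2]
    gcongr
    rw [norm_mul]
    exact mul_le_of_le_one_left (norm_nonneg _) (ht k i)

end Contraction

end RadAlpha

/-- A Banach space `X` has property (α) if and only if the maps
`σ_{n,X} : M_n → B(Rad_n(X))` are `R`-bounded uniformly in `n`. -/
theorem propertyAlpha_iff_sigma_uniformly_rBounded (X : Type*) [NormedAddCommGroup X]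
    [NormedSpace ℂ X] [CompleteSpace X] :
    PropertyAlpha X ↔ ∃ C : ℝ, ∀ n : ℕ, SigmaRBoundedWith X C n :=
  ⟨RadAlpha.exists_sigmaRBoundedWith_of_propertyAlpha,
    fun ⟨_, h⟩ => RadAlpha.propertyAlpha_of_sigmaRBoundedWith h⟩
end
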